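/- arXiv:1806.04980 — 2 statements merged into one kernel-verified Lean document; each statement's English description precedes it below -/
import Mathlib

section
/- Let f(X) ∈ ℂ(X) be a rational function of degree d ≥ 2, and suppose that for some n ≥ 1 the n-th compositional iterate f^n(X) is a polynomial, i.e., f^n ∈ ℂ[X]. Then already the second iterate satisfies f²(X) ∈ ℂ[X]. -/
/-- Composition of rational functions: (f ∘ g)(X) = num_f(g(X)) / denom_f(g(X)). -/
noncomputable def rfComp {K : Type*} [Field K] (f g : RatFunc K) : RatFunc K :=
  Polynomial.aeval g f.num / Polynomial.aeval g f.denom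

/-- The n-th compositional iterate of a rational function; `rfIter f 0 = X`. -/
noncomputable def rfIter {K : Type*} [Field K] (f : RatFunc K) : ℕ → RatFunc K
  | 0 => RatFunc.X
  | n + 1 => rfComp f (rfIter f n)

/-- A rational function is a polynomial if it lies in the image of K[X] in K(X). -/
def RatFunc.IsPoly {K : Type*} [Field K] (f : RatFunc K) : Prop :=
  ∃ P : Polynomial K, f = algebraMap (Polynomial K) (RatFunc K) P

open Polynomial

namespace RatFunc

section Homogenization

variable {K R S : Type*} [Field K] [CommRing R] [Algebra K R] [CommRing S] [Algebra K S]

/-- The degree-`d` homogenization of `P`, evaluated at the pair `(a, b)`. -/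
noncomputable def homEval (d : ℕ) (P : K[X]) (a b : R) : R :=
  ∑ i ∈ Finset.range (d + 1), algebraMap K R (P.coeff i) * a ^ i * b ^ (d - i)

theorem map_homEval (φ : R →ₐ[K] S) (d : ℕ) (P : K[X]) (a b : R) :
    φ (homEval d P a b) = homEval d P (φ a) (φ b) := by
  simp [homEval, map_sum]

theorem homEval_zero_right (d : ℕ) (P : K[X]) (a : R) :
    homEval d P a 0 = algebraMap K R (P.coeff d) * a ^ d := by
  rw [homEval, Finset.sum_range_succ, Finset.sum_eq_zero]
  · simp
  · intro i hi
    have : d - i ≠ 0 := by have := Finset.mem_range.mp hi; omega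
    simp [this]

theorem homEval_eq_pow_mul_aeval {L : Type*} [Field L] [Algebra K L] {d : ℕ} {P : K[X]}
    (hP : P.natDegree ≤ d) (a : L) {b : L} (hb : b ≠ 0) :
    homEval d P a b = b ^ d * aeval (a / b) P := by
  rw [aeval_eq_sum_range' (Nat.lt_succ_of_le hP), homEval, Finset.mul_sum]
  refine Finset.sum_congr rfl fun i hi => ?_
  have hi : i ≤ d := Nat.lt_succ_iff.mp (Finset.mem_range.mp hi)
  rw [Algebra.smul_def, div_pow, ← Nat.sub_add_cancel hi, pow_add, Nat.sub_add_cancel hi]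
  field_simp

end Homogenization

section Evaluation

variable {K : Type*} [Field K]

open scoped Classical in
/-- The point `[a : b]` of the projective line, as an element of `OnePoint K`. -/
noncomputable def projPoint (a b : K) : OnePoint K :=
  if b = 0 then OnePoint.infty else ((a / b : K) : OnePoint K)

theorem projPoint_zero (a : K) : projPoint a 0 = OnePoint.infty := if_pos rfl

theorem projPoint_of_ne {a b : K} (hb : b ≠ 0) :
    projPoint a b = ((a / b : K) : OnePoint K) := if_neg hb

theorem projPoint_eq_infty_iff {a b : K} : projPoint a b = OnePoint.infty ↔ b = 0 := by
  by_cases hb : b = 0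
  · simp [hb, projPoint_zero]
  · simp [hb, projPoint_of_ne]

theorem projPoint_eq_coe_iff {a b c : K} :
    projPoint a b = (c : OnePoint K) ↔ b ≠ 0 ∧ a - c * b = 0 := by
  by_cases hb : b = 0
  · simp [hb, projPoint_zero]
  · rw [projPoint_of_ne hb, OnePoint.coe_eq_coe, div_eq_iff hb, sub_eq_zero]
    simp [hb]

theorem projPoint_mul_left {k : K} (hk : k ≠ 0) (a b : K) :
    projPoint (k * a) (k * b) = projPoint a b := by
  by_cases hb : b = 0
  · simp [hb, projPoint_zero]
  · rw [projPoint_of_ne hb, projPoint_of_ne (mul_ne_zero hk hb), mul_div_mul_left _ _ hk]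

/-- The degree of a rational function. -/
noncomputable def mapDegree (f : RatFunc K) : ℕ := max f.num.natDegree f.denom.natDegree

theorem natDegree_num_le_mapDegree (f : RatFunc K) : f.num.natDegree ≤ f.mapDegree :=
  le_max_left _ _

theorem natDegree_denom_le_mapDegree (f : RatFunc K) : f.denom.natDegree ≤ f.mapDegree :=
  le_max_right _ _

/-- The self-map of the projective line induced by a rational function. -/
noncomputable def projEval (f : RatFunc K) : OnePoint K → OnePoint K
  | none => projPoint (f.num.coeff f.mapDegree) (f.denom.coeff f.mapDegree)
  | some x => projPoint (f.num.eval x) (f.denom.eval x)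

theorem projEval_infty (f : RatFunc K) : f.projEval OnePoint.infty =
    projPoint (f.num.coeff f.mapDegree) (f.denom.coeff f.mapDegree) := rfl

theorem projEval_coe (f : RatFunc K) (x : K) :
    f.projEval x = projPoint (f.num.eval x) (f.denom.eval x) := rfl

theorem num_eval_ne_zero_of_denom_eval_eq_zero (f : RatFunc K) {x : K}
    (hx : f.denom.eval x = 0) : f.num.eval x ≠ 0 := by
  obtain ⟨a, b, hab⟩ := f.isCoprime_num_denom
  intro h
  simpa [h, hx] using congrArg (Polynomial.eval x) hab

theorem num_coeff_mapDegree_ne_zero (f : RatFunc K)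
    (h : f.denom.coeff f.mapDegree = 0) : f.num.coeff f.mapDegree ≠ 0 := by
  rcases le_total f.num.natDegree f.denom.natDegree with hle | hle
  · rw [mapDegree, max_eq_right hle] at h
    exact absurd (leadingCoeff_eq_zero.mp h) f.denom_ne_zero
  · rw [mapDegree, max_eq_left hle] at h ⊢
    intro h0
    have hn : f.num = 0 := leadingCoeff_eq_zero.mp h0
    have hd : f.denom.natDegree = 0 := by simpa [hn] using hle
    rw [hn, natDegree_zero, ← hd] at h
    exact f.denom_ne_zero (leadingCoeff_eq_zero.mp h)

theorem projEval_projPoint (f : RatFunc K) {a b : K} (hab : b = 0 → a ≠ 0) :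
    f.projEval (projPoint a b) =
      projPoint (homEval f.mapDegree f.num a b) (homEval f.mapDegree f.denom a b) := by
  by_cases hb : b = 0
  · subst hb
    simp only [projPoint_zero, projEval_infty, homEval_zero_right, Algebra.algebraMap_self,
      RingHom.id_apply]
    rw [mul_comm, mul_comm (f.denom.coeff _), projPoint_mul_left (pow_ne_zero _ (hab rfl))]
  · rw [projPoint_of_ne hb, projEval_coe, homEval_eq_pow_mul_aeval f.natDegree_num_le_mapDegree _ hb,
      homEval_eq_pow_mul_aeval f.natDegree_denom_le_mapDegree _ hb, projPoint_mul_left (pow_ne_zero _ hb),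
      coe_aeval_eq_eval]

theorem homEval_num_ne_zero (f : RatFunc K) {a b : K} (hab : b = 0 → a ≠ 0)
    (h : homEval f.mapDegree f.denom a b = 0) : homEval f.mapDegree f.num a b ≠ 0 := by
  by_cases hb : b = 0
  · subst hb
    have ha := pow_ne_zero f.mapDegree (hab rfl)
    rw [homEval_zero_right] at h ⊢
    exact mul_ne_zero (f.num_coeff_mapDegree_ne_zero ((mul_eq_zero.mp h).resolve_right ha)) ha
  · have hbd := pow_ne_zero f.mapDegree hb
    rw [homEval_eq_pow_mul_aeval f.natDegree_denom_le_mapDegree _ hb, coe_aeval_eq_eval] at h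
    rw [homEval_eq_pow_mul_aeval f.natDegree_num_le_mapDegree _ hb, coe_aeval_eq_eval]
    exact mul_ne_zero hbd
      (f.num_eval_ne_zero_of_denom_eval_eq_zero ((mul_eq_zero.mp h).resolve_left hbd))

theorem projEval_coe_eq_of_eq_div {f : RatFunc K} {N D : K[X]} (hD : D ≠ 0)
    (hf : f = algebraMap K[X] (RatFunc K) N / algebraMap K[X] (RatFunc K) D) {x : K}
    (hx : D.eval x = 0 → N.eval x ≠ 0) :
    f.projEval x = projPoint (N.eval x) (D.eval x) := by
  have h : f.num * D = N * f.denom := (num_mul_eq_mul_denom_iff hD).mpr hf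
  have hx' := congrArg (Polynomial.eval x) h
  simp only [Polynomial.eval_mul] at hx'
  rw [projEval_coe]
  by_cases h0 : D.eval x = 0
  · have : f.denom.eval x = 0 := by simpa [h0, hx h0] using hx'
    rw [h0, this, projPoint_zero, projPoint_zero]
  · have hd : f.denom.eval x ≠ 0 := by
      intro hd
      have := f.num_eval_ne_zero_of_denom_eval_eq_zero hd
      simp_all
    rw [projPoint_of_ne h0, projPoint_of_ne hd, OnePoint.coe_eq_coe, div_eq_div_iff hd h0, hx']

theorem projEval_rfComp (f g : RatFunc K)
    (hne : ∃ y : K, f.projEval (g.projEval y) ≠ OnePoint.infty) (x : K) :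
    (rfComp f g).projEval x = f.projEval (g.projEval x) := by
  set N : K[X] := homEval f.mapDegree f.num g.num g.denom with hN
  set D : K[X] := homEval f.mapDegree f.denom g.num g.denom with hD
  have heval (P : K[X]) (y : K) : (homEval f.mapDegree P g.num g.denom).eval y =
      homEval f.mapDegree P (g.num.eval y) (g.denom.eval y) := by
    simpa only [coe_aeval_eq_eval] using map_homEval (aeval y) f.mapDegree P g.num g.denom
  have hcomp (y : K) : f.projEval (g.projEval y) = projPoint (N.eval y) (D.eval y) := by
    rw [projEval_coe, f.projEval_projPoint g.num_eval_ne_zero_of_denom_eval_eq_zero, hN, hD,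
      heval, heval]
  have hD0 : D ≠ 0 := by
    rintro h0
    obtain ⟨y, hy⟩ := hne
    exact hy (by rw [hcomp, h0, Polynomial.eval_zero, projPoint_zero])
  rw [hcomp]
  refine projEval_coe_eq_of_eq_div hD0 ?_ ?_
  · have hg : algebraMap K[X] (RatFunc K) g.denom ≠ 0 := by
      simpa using g.denom_ne_zero
    have hmap (P : K[X]) (hP : P.natDegree ≤ f.mapDegree) :
        algebraMap K[X] (RatFunc K) (homEval f.mapDegree P g.num g.denom) =
          algebraMap K[X] (RatFunc K) g.denom ^ f.mapDegree * aeval g P := by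
      have := map_homEval (IsScalarTower.toAlgHom K K[X] (RatFunc K)) f.mapDegree P g.num g.denom
      simp only [IsScalarTower.coe_toAlgHom'] at this
      rw [this, homEval_eq_pow_mul_aeval hP _ hg, num_div_denom]
    rw [hN, hD, hmap _ f.natDegree_num_le_mapDegree, hmap _ f.natDegree_denom_le_mapDegree,
      mul_div_mul_left _ _ (pow_ne_zero _ hg), rfComp]
  · rw [hN, hD, heval, heval]
    exact f.homEval_num_ne_zero g.num_eval_ne_zero_of_denom_eval_eq_zero

variable [IsAlgClosed K]

theorem projEval_surjective {f : RatFunc K} (hf : f.mapDegree ≠ 0) :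
    Function.Surjective f.projEval := by
  have root_or (P : K[X]) : (∃ x, P.eval x = 0) ∨ P.coeff f.mapDegree = 0 := by
    by_cases hP : P.degree = 0
    · rw [eq_C_of_degree_eq_zero hP, coeff_C, if_neg hf]
      exact Or.inr rfl
    · exact Or.inl (IsAlgClosed.exists_root P hP)
  intro y
  induction y using OnePoint.rec with
  | infty =>
    rcases root_or f.denom with ⟨x, hx⟩ | h
    · exact ⟨x, projPoint_eq_infty_iff.mpr hx⟩
    · exact ⟨OnePoint.infty, projPoint_eq_infty_iff.mpr h⟩
  | coe c =>
    rcases root_or (f.num - Polynomial.C c * f.denom) with ⟨x, hx⟩ | h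
    · refine ⟨x, projPoint_eq_coe_iff.mpr ⟨fun h0 => ?_, by simpa using hx⟩⟩
      exact f.num_eval_ne_zero_of_denom_eval_eq_zero h0 (by simpa [h0] using hx)
    · refine ⟨OnePoint.infty, projPoint_eq_coe_iff.mpr ⟨fun h0 => ?_, by simpa using h⟩⟩
      exact f.num_coeff_mapDegree_ne_zero h0 (by simpa [h0] using h)

theorem projEval_rfIter {f : RatFunc K} (hf : f.mapDegree ≠ 0) (n : ℕ) (x : K) :
    (rfIter f n).projEval x = f.projEval^[n] x := by
  induction n generalizing x with
  | zero => simp [rfIter, projEval_coe, projPoint_of_ne]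
  | succ n ih =>
    rw [Function.iterate_succ_apply', ← ih, rfIter]
    refine projEval_rfComp f _ ?_ x
    by_contra! h
    have hinf (y : OnePoint K) (hy : f.projEval^[n + 1] y ≠ OnePoint.infty) :
        y = OnePoint.infty := by
      induction y using OnePoint.rec with
      | infty => rfl
      | coe y => exact absurd (by rw [Function.iterate_succ_apply', ← ih, h]) hy
    obtain ⟨y, hy⟩ := (projEval_surjective hf).iterate (n + 1) ((0 : K) : OnePoint K)
    obtain ⟨z, hz⟩ := (projEval_surjective hf).iterate (n + 1) ((1 : K) : OnePoint K)
    rw [hinf y (by simp [hy])] at hy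
    rw [hinf z (by simp [hz]), hy] at hz
    simp at hz

theorem isPoly_iff_projEval_coe_ne_infty (f : RatFunc K) :
    f.IsPoly ↔ ∀ x : K, f.projEval x ≠ OnePoint.infty := by
  simp only [projEval_coe, ne_eq, projPoint_eq_infty_iff]
  constructor
  · rintro ⟨P, rfl⟩ x
    simp
  · intro h
    have hdeg : f.denom.degree = 0 := by
      by_contra h0
      obtain ⟨x, hx⟩ := IsAlgClosed.exists_root f.denom h0
      exact h x hx
    refine ⟨f.num, ?_⟩
    have h1 : f.denom = 1 :=
      f.monic_denom.natDegree_eq_zero.mp (natDegree_eq_of_degree_eq_some hdeg)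
    simpa [h1] using (num_div_denom f).symm

theorem isPoly_rfIter_iff {f : RatFunc K} (hf : f.mapDegree ≠ 0) (n : ℕ) :
    (rfIter f n).IsPoly ↔ ∀ y, f.projEval^[n] y = OnePoint.infty → y = OnePoint.infty := by
  simp only [isPoly_iff_projEval_coe_ne_infty, projEval_rfIter hf]
  constructor
  · intro h y hy
    induction y using OnePoint.rec with
    | infty => rfl
    | coe x => exact absurd hy (h x)
  · intro h x hx
    simpa using h x hx

end Evaluation

end RatFunc

theorem Polynomial.eq_C_mul_X_sub_C_pow {K : Type*} [Field K] [IsAlgClosed K] {P : K[X]} {d : ℕ}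
    {p : K} (hP : P.natDegree = d) (h : ∀ x, P.eval x = 0 → x = p) :
    P = C P.leadingCoeff * (X - C p) ^ d := by
  have hs := IsAlgClosed.splits P
  have hr : P.roots = Multiset.replicate d p := by
    rw [Multiset.eq_replicate]
    exact ⟨by rw [← hP, hs.natDegree_eq_card_roots], fun x hx => h x (isRoot_of_mem_roots hx)⟩
  conv_lhs => rw [hs.eq_prod_roots, hr]
  simp

/-- Powers `(X - q) ^ d`, `(X - r) ^ d` and `(X - p) ^ d` with `2 ≤ d` and `p ≠ q` satisfy no
linear relation in which the first and the last occur with nonzero coefficients. -/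
theorem Polynomial.not_C_mul_pow_sub_eq {K : Type*} [Field K] [CharZero K] {d : ℕ} (hd : 2 ≤ d)
    {c e p q : K} (hc : c ≠ 0) (he : e ≠ 0) (hpq : p ≠ q) (c' r : K) :
    C c * (X - C q) ^ d - C c' * (X - C r) ^ d ≠ C e * (X - C p) ^ d := by
  intro h
  obtain ⟨m, rfl⟩ : ∃ m, d = m + 1 := ⟨d - 1, by omega⟩
  have hm : m ≠ 0 := by omega
  have hm1 : (m : K) + 1 ≠ 0 := by exact_mod_cast m.succ_ne_zero
  have key (x : K) : c * (x - q) ^ m * (r - q) = e * (x - p) ^ m * (r - p) := by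
    have h0 := congrArg (eval x) h
    have h1 := congrArg (fun P => eval x (derivative P)) h
    simp [derivative_X_sub_C_pow] at h0 h1
    have h2 : c * (x - q) ^ m - c' * (x - r) ^ m = e * (x - p) ^ m := by
      apply mul_left_cancel₀ hm1
      linear_combination h1
    linear_combination h0 - (x - r) * h2
  have hr : r - p = 0 := by simpa [hm, he, sub_ne_zero.mpr hpq.symm] using (key q).symm
  have hr' : r - q = 0 := by simpa [hm, hc, sub_ne_zero.mpr hpq] using key p
  exact hpq ((sub_eq_zero.mp hr).symm.trans (sub_eq_zero.mp hr'))

theorem Polynomial.not_C_mul_pow_sub_eq_C {K : Type*} [Field K] [CharZero K] {d : ℕ} (hd : 2 ≤ d)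
    {e p q : K} (he : e ≠ 0) (hpq : p ≠ q) (c c' : K) :
    C c * (X - C q) ^ d - C c' ≠ C e * (X - C p) ^ d := by
  intro h
  have h1 := congrArg (fun P => eval q (derivative P)) h
  have hd0 : d ≠ 0 := by omega
  have hd1 : d - 1 ≠ 0 := by omega
  simp [derivative_X_sub_C_pow, hd0, hd1, he, sub_ne_zero.mpr hpq.symm] at h1

/-- A rational function of degree at least two does not have singleton fibres over three distinct
points `∞`, `p`, `q`, when the fibres over `∞` and `p` are `p` and `q`. -/
theorem RatFunc.not_three_singleton_fibres {K : Type*} [Field K] [IsAlgClosed K] [CharZero K]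
    {f : RatFunc K} (hf : 2 ≤ f.mapDegree) {p q : K} {r : OnePoint K} (hpq : p ≠ q)
    (h₁ : ∀ y, f.projEval y = OnePoint.infty → y = p) (h₂ : ∀ y, f.projEval y = p → y = q)
    (h₃ : ∀ y, f.projEval y = q → y = r) : False := by
  have hlead (c : K) : f.projEval OnePoint.infty ≠ c → f.denom.coeff f.mapDegree ≠ 0 →
      (f.num - Polynomial.C c * f.denom).coeff f.mapDegree ≠ 0 := by
    intro h hG h0
    exact h (projPoint_eq_coe_iff.mpr ⟨hG, by simpa using h0⟩)
  have hfib {c : K} {x : K} (hx : (f.num - Polynomial.C c * f.denom).eval x = 0) : f.projEval x = c := by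
    refine projPoint_eq_coe_iff.mpr ⟨fun h0 => ?_, by simpa using hx⟩
    exact f.num_eval_ne_zero_of_denom_eval_eq_zero h0 (by simpa [h0] using hx)
  have hle (c : K) : (f.num - Polynomial.C c * f.denom).natDegree ≤ f.mapDegree :=
    (natDegree_sub_le _ _).trans
      (max_le_max le_rfl (natDegree_C_mul_le c f.denom))
  have hG : f.denom.coeff f.mapDegree ≠ 0 := fun h0 => by
    simpa using h₁ OnePoint.infty (projPoint_eq_infty_iff.mpr h0)
  have hGd := eq_C_mul_X_sub_C_pow (P := f.denom)
    (natDegree_eq_of_le_of_coeff_ne_zero f.natDegree_denom_le_mapDegree hG)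
    fun x hx => by simpa using h₁ x (projPoint_eq_infty_iff.mpr hx)
  have hp := hlead p (fun h => by simpa using h₂ _ h) hG
  have hpd := eq_C_mul_X_sub_C_pow (natDegree_eq_of_le_of_coeff_ne_zero (hle p) hp)
    fun x hx => by simpa using h₂ x (hfib hx)
  have hid : (f.num - Polynomial.C p * f.denom) - (f.num - Polynomial.C q * f.denom) =
      Polynomial.C ((q - p) * f.denom.leadingCoeff) * (Polynomial.X - Polynomial.C p) ^ f.mapDegree := by
    rw [C_mul, mul_assoc, ← hGd, C_sub]
    ring
  have he : (q - p) * f.denom.leadingCoeff ≠ 0 :=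
    mul_ne_zero (sub_ne_zero.mpr hpq.symm) (leadingCoeff_ne_zero.mpr f.denom_ne_zero)
  have hc : (f.num - Polynomial.C p * f.denom).leadingCoeff ≠ 0 :=
    leadingCoeff_ne_zero.mpr fun h0 => hp (by rw [h0, coeff_zero])
  induction r using OnePoint.rec with
  | infty =>
    have hqd : f.num - Polynomial.C q * f.denom = Polynomial.C ((f.num - Polynomial.C q * f.denom).coeff 0) := by
      apply eq_C_of_degree_le_zero
      by_contra! h0
      obtain ⟨x, hx⟩ := IsAlgClosed.exists_root _ h0.ne'
      simpa using h₃ x (hfib hx)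
    rw [hpd, hqd] at hid
    exact not_C_mul_pow_sub_eq_C hf he hpq _ _ hid
  | coe r =>
    have hqd := eq_C_mul_X_sub_C_pow
      (natDegree_eq_of_le_of_coeff_ne_zero (hle q) (hlead q (fun h => by simpa using h₃ _ h) hG))
      fun x hx => by simpa using h₃ x (hfib hx)
    rw [hpd, hqd] at hid
    exact not_C_mul_pow_sub_eq hf hc he hpq _ _ hid

/-- If `φ` is surjective and `φ^[n]` has fibre `{a}` over `a`, then `φ` has singleton
fibres along the backward orbit of `a`. -/
theorem Function.Surjective.eq_iterate_of_iterate_eq {α : Type*} {φ : α → α}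
    (hφ : Function.Surjective φ) {a : α} {n : ℕ} (h : ∀ y, φ^[n] y = a → y = a) {k : ℕ}
    (hk : k + 1 ≤ n) {y : α} (hy : φ y = φ^[k + 1] a) : y = φ^[k] a := by
  obtain ⟨z, rfl⟩ := hφ.iterate k y
  obtain ⟨w, hw⟩ := hφ.iterate n a
  have ha : φ^[n] a = a := by rwa [h w hw] at hw
  rw [← Function.iterate_succ_apply' φ k z] at hy
  have hz : φ^[n] z = a := by
    rw [← Nat.sub_add_cancel hk, Function.iterate_add_apply, hy, ← Function.iterate_add_apply,
      Nat.sub_add_cancel hk, ha]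
  rw [h z hz]

/-- if f ∈ ℂ(X) has degree d ≥ 2 and some iterate f^n (n ≥ 1) is a
polynomial, then already f² is a polynomial. -/
theorem iterate_polynomial_implies_second_iterate_polynomial
    (f : RatFunc ℂ) (hdeg : 2 ≤ max f.num.natDegree f.denom.natDegree)
    (n : ℕ) (hn : 1 ≤ n) (h : (rfIter f n).IsPoly) :
    (rfIter f 2).IsPoly := by
  have hf : 2 ≤ f.mapDegree := hdeg
  have hf0 : f.mapDegree ≠ 0 := by omega
  have hsurj := RatFunc.projEval_surjective hf0
  rw [RatFunc.isPoly_rfIter_iff hf0] at h ⊢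
  have h3 : ∀ y, f.projEval^[n * 3] y = OnePoint.infty → y = OnePoint.infty := fun y hy => by
    rw [Function.iterate_mul] at hy
    exact h _ (h _ (h _ hy))
  obtain ⟨m, hm⟩ : ∃ m, n * 3 = m + 3 := ⟨n * 3 - 3, by omega⟩
  rw [hm] at h3
  have hinf : f.projEval^[m + 3] OnePoint.infty = OnePoint.infty := by
    obtain ⟨w, hw⟩ := hsurj.iterate (m + 3) OnePoint.infty
    rwa [h3 w hw] at hw
  have h₁ (y : OnePoint ℂ) (hy : f.projEval y = OnePoint.infty) :
      y = f.projEval^[m + 2] OnePoint.infty :=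
    hsurj.eq_iterate_of_iterate_eq h3 (k := m + 2) (by omega) (hy.trans hinf.symm)
  have h₂ (y : OnePoint ℂ) (hy : f.projEval y = f.projEval^[m + 2] OnePoint.infty) :
      y = f.projEval^[m + 1] OnePoint.infty :=
    hsurj.eq_iterate_of_iterate_eq h3 (k := m + 1) (by omega) hy
  have h₃ (y : OnePoint ℂ) (hy : f.projEval y = f.projEval^[m + 1] OnePoint.infty) :
      y = f.projEval^[m] OnePoint.infty :=
    hsurj.eq_iterate_of_iterate_eq h3 (k := m) (by omega) hy
  have hp : f.projEval (f.projEval^[m + 2] OnePoint.infty) = OnePoint.infty := by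
    rw [← Function.iterate_succ_apply' f.projEval, hinf]
  have hq : f.projEval (f.projEval^[m + 1] OnePoint.infty) =
      f.projEval^[m + 2] OnePoint.infty := by
    rw [← Function.iterate_succ_apply' f.projEval]
  generalize f.projEval^[m + 2] OnePoint.infty = p at *
  generalize f.projEval^[m + 1] OnePoint.infty = q at *
  generalize f.projEval^[m] OnePoint.infty = r at *
  intro y hy
  have hyq : y = q := h₂ y (h₁ _ hy)
  rw [hyq]
  by_contra hq0
  have hp0 : p ≠ OnePoint.infty := fun hp0 => by
    rw [hp0] at hp h₂
    exact hq0 ((h₂ _ hp).symm)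
  obtain ⟨q, rfl⟩ := OnePoint.ne_infty_iff_exists.mp hq0
  obtain ⟨p, rfl⟩ := OnePoint.ne_infty_iff_exists.mp hp0
  refine RatFunc.not_three_singleton_fibres hf (p := p) (q := q) ?_ h₁ h₂ h₃
  rintro rfl
  exact hp0 (hq.symm.trans hp)
end

section
/- Let f(X) ∈ ℚ(X) be a rational function of degree at least 2, and assume that the second iterate f²(X) is not a polynomial. Then for every α ∈ ℚ, the forward orbit of α under f contains only finitely many integers; that is, the set {f^n(α) : n ≥ 0, f^n(α) defined} ∩ ℤ is finite. -/
attribute [local instance] Classical.propDecidable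

/-- The self-map of P¹(K) = K ∪ {∞} (modelled as `Option K`, with `none` = ∞) induced by a
rational function f = num/denom: at a finite non-pole it is the usual value; at a pole it
is ∞; at ∞ it is ∞, 0, or the ratio of leading coefficients according to the comparison
of the degrees of the numerator and the denominator. -/
noncomputable def P1map {K : Type*} [Field K] (f : RatFunc K) : Option K → Option K
  | some x =>
      if f.denom.eval x = 0 then none else some (f.num.eval x / f.denom.eval x)
  | none =>
      if f.denom.natDegree < f.num.natDegree then none
      else if f.num.natDegree < f.denom.natDegree then some 0
      else some (f.num.leadingCoeff / f.denom.leadingCoeff)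

open Polynomial

namespace Silverman

lemma exists_coeff_bound (h : ℤ[X]) : ∃ H : ℕ, 1 ≤ H ∧ ∀ i, |h.coeff i| ≤ H := by
  refine ⟨h.support.sup (fun i => (h.coeff i).natAbs) + 1, by omega, fun i => ?_⟩
  by_cases hi : i ∈ h.support
  · have := Finset.le_sup (f := fun i => (h.coeff i).natAbs) hi
    rw [Int.abs_eq_natAbs]
    exact_mod_cast this.trans (Nat.le_succ _)
  · rw [notMem_support_iff.mp hi]
    simp only [abs_zero]
    positivity

lemma exists_coords (h : ℤ[X]) (hd : 0 < h.natDegree) :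
    ∃ B : ℕ, 1 ≤ B ∧ |h.leadingCoeff| ≤ B ∧ ∀ n, ∃ c : ℕ → ℤ, (∀ l, |c l| ≤ (B : ℤ) ^ n) ∧
      ∀ β : ℂ, aeval β h = 0 →
        (h.leadingCoeff : ℂ) ^ n * β ^ n = ∑ l ∈ Finset.range h.natDegree, (c l : ℂ) * β ^ l := by
  obtain ⟨H, hH1, hH⟩ := exists_coeff_bound h
  have hlc : |h.leadingCoeff| ≤ H := hH _
  refine ⟨2 * H, by omega, by push_cast; linarith [hH1], fun n => ?_⟩
  obtain ⟨E, hE⟩ : ∃ E, h.natDegree = E + 1 := ⟨h.natDegree - 1, by omega⟩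
  induction n with
  | zero =>
    refine ⟨fun l => if l = 0 then 1 else 0, fun l => ?_, fun β _ => ?_⟩
    · by_cases hl : l = 0 <;> simp [hl]
    · rw [hE, Finset.sum_range_succ']
      simp
  | succ n ih =>
    obtain ⟨c, hc, hβ⟩ := ih
    refine ⟨fun l => (if l = 0 then 0 else h.leadingCoeff * c (l - 1)) - c E * h.coeff l,
      fun l => ?_, fun β hroot => ?_⟩
    · have h1 : |if l = 0 then 0 else h.leadingCoeff * c (l - 1)| ≤ H * ((2 * H : ℕ) : ℤ) ^ n := by
        split_ifs
        · simp only [abs_zero]; positivity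
        · rw [abs_mul]
          exact mul_le_mul hlc (hc _) (abs_nonneg _) (by positivity)
      have h2 : |c E * h.coeff l| ≤ ((2 * H : ℕ) : ℤ) ^ n * H := by
        rw [abs_mul]
        exact mul_le_mul (hc _) (hH _) (abs_nonneg _) (by positivity)
      calc _ ≤ _ := abs_sub _ _
        _ ≤ _ := add_le_add h1 h2
        _ = _ := by push_cast; ring
    · have h0 : (h.leadingCoeff : ℂ) * β ^ (E + 1) +
          ∑ l ∈ Finset.range (E + 1), (h.coeff l : ℂ) * β ^ l = 0 := by
        rw [aeval_eq_sum_range, hE, Finset.sum_range_succ] at hroot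
        rw [← hroot, add_comm, leadingCoeff, hE]
        simp [zsmul_eq_mul]
      have key := hβ β hroot
      rw [hE] at key ⊢
      rw [pow_succ, pow_succ, mul_mul_mul_comm, key]
      simp only [Int.cast_sub, sub_mul, Finset.sum_sub_distrib, Int.cast_mul, mul_assoc]
      rw [← Finset.mul_sum, Finset.sum_range_succ' (fun l => ((if l = 0 then 0 else _ : ℤ) : ℂ) * β ^ l),
        Finset.sum_range_succ, ← sub_eq_zero]
      simp only [if_true, Nat.add_eq_zero_iff, one_ne_zero, and_false, if_false, Nat.add_sub_cancel,
        Int.cast_mul, Int.cast_zero, zero_mul, add_zero, add_mul, Finset.sum_mul]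
      have e : ∑ x ∈ Finset.range E, (c x : ℂ) * β ^ x * (↑h.leadingCoeff * β) =
          ∑ x ∈ Finset.range E, ↑h.leadingCoeff * (c x : ℂ) * β ^ (x + 1) :=
        Finset.sum_congr rfl fun x _ => by ring
      rw [e]
      linear_combination (c E : ℂ) * h0

lemma exists_coords_scaled (h : ℤ[X]) (hd : 0 < h.natDegree) :
    ∃ B : ℕ, 1 ≤ B ∧ ∀ N m, ∃ c : ℕ → ℤ, m ≤ N → (∀ l, |c l| ≤ (B : ℤ) ^ N) ∧
      ∀ β : ℂ, aeval β h = 0 →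
        (h.leadingCoeff : ℂ) ^ N * β ^ m = ∑ l ∈ Finset.range h.natDegree, (c l : ℂ) * β ^ l := by
  obtain ⟨B, hB, hlc, H⟩ := exists_coords h hd
  refine ⟨B, hB, fun N m => ?_⟩
  obtain ⟨c, hc, hβ⟩ := H m
  refine ⟨fun l => h.leadingCoeff ^ (N - m) * c l, fun hm => ⟨fun l => ?_, fun β hroot => ?_⟩⟩
  · rw [abs_mul, abs_pow, ← Nat.sub_add_cancel hm, pow_add, Nat.sub_add_cancel hm]
    exact mul_le_mul (pow_le_pow_left₀ (abs_nonneg _) hlc _) (hc _) (abs_nonneg _) (by positivity)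
  · simp only [Int.cast_mul, Int.cast_pow, mul_assoc]
    rw [← Finset.mul_sum, ← hβ β hroot, ← mul_assoc, ← pow_add, Nat.sub_add_cancel hm]

attribute [local instance] Matrix.seminormedAddCommGroup in

/-- Siegel's lemma, with the exponent specialised to a system in the ratio `12 : 14`. -/
lemma siegel {α β : Type*} [Fintype α] [Fintype β] (A : Matrix α β ℤ) (r : ℕ) (hr : 0 < r)
    (hα : Fintype.card α = 12 * r) (hβ : Fintype.card β = 14 * r) (M : ℕ) (hM : 1 ≤ M)
    (hA : ∀ i j, |A i j| ≤ M) :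
    ∃ t : β → ℤ, t ≠ 0 ∧ A.mulVec t = 0 ∧ ∀ j, |t j| ≤ (14 * r * M : ℤ) ^ 6 := by
  obtain ⟨t, ht, h0, hn⟩ := Int.Matrix.exists_ne_zero_int_vec_norm_le A (by omega) (by omega)
  refine ⟨t, ht, h0, fun j => ?_⟩
  have hAM : ‖A‖ ≤ M := by
    rw [Matrix.norm_le_iff (by positivity)]
    intro i j
    rw [Int.norm_eq_abs]
    exact_mod_cast hA i j
  have hr' : (0 : ℝ) < r := by exact_mod_cast hr
  have hexp : ((Fintype.card α : ℝ) / ((Fintype.card β : ℝ) - Fintype.card α)) = (6 : ℕ) := by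
    rw [hα, hβ]
    push_cast
    field_simp
    norm_num
  rw [hexp, Real.rpow_natCast] at hn
  have h2 : (|t j| : ℝ) ≤ (14 * r * M : ℝ) ^ 6 := by
    calc (|t j| : ℝ) = ‖t j‖ := (Int.norm_eq_abs _).symm
      _ ≤ ‖t‖ := norm_le_pi_norm t j
      _ ≤ _ := hn
      _ ≤ _ := by
        rw [hβ]
        push_cast
        gcongr
        exact max_le (by exact_mod_cast hM) hAM
  exact_mod_cast h2

lemma exists_aux (h : ℤ[X]) (hd : 0 < h.natDegree) :
    ∃ C₀ : ℕ, 1 ≤ C₀ ∧ ∀ s, 0 < s → ∃ P Q : ℤ[X], (P ≠ 0 ∨ Q ≠ 0) ∧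
      P.degree < (7 * h.natDegree * s : ℕ) ∧ Q.degree < (7 * h.natDegree * s : ℕ) ∧
      (∀ i, |P.coeff i| ≤ (C₀ : ℤ) ^ s) ∧ (∀ i, |Q.coeff i| ≤ (C₀ : ℤ) ^ s) ∧
      ∀ β : ℂ, aeval β h = 0 → (X - C β) ^ (12 * s) ∣
        P.map (Int.castRingHom ℂ) - C β * Q.map (Int.castRingHom ℂ) := by
  obtain ⟨B, hB, H⟩ := exists_coords_scaled h hd
  choose c hc using H
  set D := h.natDegree with hD
  refine ⟨(2 ^ (14 * D) * (2 * B) ^ (7 * D)) ^ 6, Nat.one_le_pow _ _ (by positivity), fun s hs => ?_⟩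
  set N := 7 * D * s with hN
  let A : Matrix (Fin (12 * s) × Fin D) (Fin N ⊕ Fin N) ℤ := fun jl i =>
    Sum.elim (fun i : Fin N => (Nat.choose i jl.1 : ℤ) * c N (i - jl.1) jl.2)
      (fun i : Fin N => -((Nat.choose i jl.1 : ℤ) * c N (i - jl.1 + 1) jl.2)) i
  have hbd : ∀ (i j m l : ℕ), i < N → m ≤ N → |(Nat.choose i j : ℤ) * c N m l| ≤ ((2 * B) ^ N : ℕ) := by
    intro i j m l hi hm
    rw [abs_mul, mul_pow]
    push_cast
    refine mul_le_mul ?_ ((hc N m hm).1 l) (abs_nonneg _) (by positivity)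
    rw [Nat.abs_cast]
    have h1 : Nat.choose i j ≤ 2 ^ N :=
      (Nat.choose_le_two_pow i j).trans (Nat.pow_le_pow_right (by norm_num) hi.le)
    exact_mod_cast h1
  obtain ⟨t, ht0, hAt, ht⟩ := siegel A (D * s) (by positivity) (by simp; ring)
    (by simp [hN]; ring) ((2 * B) ^ N) (Nat.one_le_pow _ _ (by omega)) (by
      rintro ⟨j, l⟩ (i | i)
      · exact hbd i j (i - j) l i.2 ((Nat.sub_le _ _).trans i.2.le)
      · simp only [A, Sum.elim_inr, abs_neg]
        exact hbd i j (i - j + 1) l i.2 (by have := i.2; omega))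
  have htb : ∀ j, |t j| ≤ (((2 ^ (14 * D) * (2 * B) ^ (7 * D)) ^ 6 : ℕ) : ℤ) ^ s := by
    intro j
    refine (ht j).trans ?_
    have : (14 * (D * s) * (2 * B) ^ N) ^ 6 ≤ ((2 ^ (14 * D) * (2 * B) ^ (7 * D)) ^ 6) ^ s := by
      rw [pow_right_comm (2 ^ (14 * D) * (2 * B) ^ (7 * D)) 6 s]
      refine Nat.pow_le_pow_left ?_ 6
      rw [mul_pow (2 ^ (14 * D)), ← pow_mul, ← pow_mul, ← hN]
      refine Nat.mul_le_mul_right _ ?_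
      rw [mul_assoc]
      exact Nat.lt_two_pow_self.le
    exact_mod_cast this
  let mk : (Fin N → ℤ) → ℤ[X] := fun u => ∑ i : Fin N, monomial (i : ℕ) (u i)
  have hcoeff : ∀ u (i : ℕ), (mk u).coeff i = if hi : i < N then u ⟨i, hi⟩ else 0 := by
    intro u i
    simp only [mk, finsetSum_coeff, coeff_monomial]
    split_ifs with hi
    · rw [Finset.sum_eq_single ⟨i, hi⟩]
      · simp
      · intro b _ hb
        rw [if_neg]
        rintro rfl
        exact hb rfl
      · simp
    · refine Finset.sum_eq_zero fun b _ => if_neg ?_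
      rintro rfl
      exact hi b.2
  have hdeg : ∀ u, (mk u).degree < (N : ℕ) := by
    intro u
    rw [degree_lt_iff_coeff_zero]
    intro m hm
    rw [hcoeff, dif_neg (by omega)]
  have hzero : ∀ u, mk u = 0 → u = 0 := by
    intro u hu
    ext i
    have := hcoeff u i
    rw [hu, dif_pos i.2] at this
    simpa using this.symm
  refine ⟨mk (fun i => t (Sum.inl i)), mk (fun i => t (Sum.inr i)), ?_, hdeg _, hdeg _, ?_, ?_, ?_⟩
  · by_contra! hcon
    apply ht0
    ext (i | i)
    · exact congrFun (hzero _ hcon.1) i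
    · exact congrFun (hzero _ hcon.2) i
  · intro i
    rw [hcoeff]
    split_ifs
    · exact htb _
    · simp only [abs_zero]; positivity
  · intro i
    rw [hcoeff]
    split_ifs
    · exact htb _
    · simp only [abs_zero]; positivity
  · intro β hβ
    rw [X_sub_C_pow_dvd_iff, ← taylor_apply, X_pow_dvd_iff]
    intro j hj
    rw [taylor_coeff]
    have ha : (h.leadingCoeff : ℂ) ^ N ≠ 0 := by
      apply pow_ne_zero
      rw [Int.cast_ne_zero, leadingCoeff_ne_zero]
      intro h0
      rw [hD, h0, natDegree_zero] at hd
      exact lt_irrefl _ hd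
    apply (mul_eq_zero.mp _).resolve_left ha
    have e1 : ∀ u : Fin N → ℤ, (hasseDeriv j ((mk u).map (Int.castRingHom ℂ))).eval β =
        ∑ i : Fin N, (Nat.choose i j : ℂ) * (u i : ℂ) * β ^ ((i : ℕ) - j) := by
      intro u
      change eval β (hasseDeriv j (Polynomial.map _ (∑ i : Fin N, monomial (i : ℕ) (u i)))) = _
      simp only [Polynomial.map_sum, map_monomial, map_sum, hasseDeriv_monomial,
        eval_finsetSum, eval_monomial, eq_intCast]
    rw [← smul_eq_C_mul, map_sub, map_smul, eval_sub, eval_smul, e1, e1, smul_eq_mul]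
    have e2 : ∀ l : Fin D, ∑ i : Fin N, ((Nat.choose i j : ℂ) * c N (i - j) l * t (Sum.inl i)) -
        ∑ i : Fin N, ((Nat.choose i j : ℂ) * c N (i - j + 1) l * t (Sum.inr i)) = 0 := by
      intro l
      have := congrFun hAt (⟨j, hj⟩, l)
      simp only [Matrix.mulVec, dotProduct, Fintype.sum_sum_type, A, Sum.elim_inl, Sum.elim_inr,
        Pi.zero_apply, neg_mul, Finset.sum_neg_distrib, ← sub_eq_add_neg] at this
      exact_mod_cast this
    have e3 : ∀ m, m ≤ N → (h.leadingCoeff : ℂ) ^ N * β ^ m = ∑ l : Fin D, (c N m l : ℂ) * β ^ (l : ℕ) := by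
      intro m hm
      rw [(hc N m hm).2 β hβ, Finset.sum_range]
    calc _ = ∑ i : Fin N, (Nat.choose i j : ℂ) * t (Sum.inl i) * (h.leadingCoeff ^ N * β ^ (i - j)) -
        ∑ i : Fin N, (Nat.choose i j : ℂ) * t (Sum.inr i) * (h.leadingCoeff ^ N * β ^ (i - j + 1)) := by
          rw [mul_sub, Finset.mul_sum, Finset.mul_sum, Finset.mul_sum]
          congr 1 <;> exact Finset.sum_congr rfl fun i _ => by ring
      _ = ∑ l : Fin D, β ^ (l : ℕ) *
          (∑ i : Fin N, ((Nat.choose i j : ℂ) * c N (i - j) l * t (Sum.inl i)) -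
          ∑ i : Fin N, ((Nat.choose i j : ℂ) * c N (i - j + 1) l * t (Sum.inr i))) := by
          simp only [mul_sub, Finset.sum_sub_distrib, Finset.mul_sum]
          congr 1 <;> rw [Finset.sum_comm] <;> refine Finset.sum_congr rfl fun i _ => ?_
          · rw [e3 _ ((Nat.sub_le _ _).trans i.2.le), Finset.mul_sum]
            exact Finset.sum_congr rfl fun i _ => by ring
          · rw [e3 _ (by have := i.2; omega), Finset.mul_sum]
            exact Finset.sum_congr rfl fun i _ => by ring
      _ = 0 := Finset.sum_eq_zero fun l _ => by rw [e2, mul_zero]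

lemma wronskian_ne_zero_of_dvd (R : Finset ℂ) (hR : 3 ≤ R.card) (s : ℕ) (p q : ℂ[X])
    (hpq : p ≠ 0 ∨ q ≠ 0) (hp : p.degree < (7 * R.card * s : ℕ)) (hq : q.degree < (7 * R.card * s : ℕ))
    (hdvd : ∀ β ∈ R, (X - C β) ^ (12 * s) ∣ p - C β * q) : wronskian p q ≠ 0 := by
  intro hW
  set g := EuclideanDomain.gcd p q with hg
  obtain ⟨u, hu⟩ : g ∣ p := EuclideanDomain.gcd_dvd_left p q
  obtain ⟨v, hv⟩ : g ∣ q := EuclideanDomain.gcd_dvd_right p q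
  have hg0 : g ≠ 0 := by
    intro h0
    rw [h0, zero_mul] at hu hv
    exact hpq.elim (· hu) (· hv)
  have huv : IsCoprime u v := by
    obtain ⟨a, b, hab⟩ : ∃ a b, g = p * a + q * b := ⟨_, _, EuclideanDomain.gcd_eq_gcd_ab p q⟩
    refine ⟨a, b, mul_left_cancel₀ hg0 ?_⟩
    linear_combination -hab - a * hu - b * hv
  have hWuv : wronskian u v = 0 := by
    have : wronskian p q = g ^ 2 * wronskian u v := by
      rw [hu, hv]
      simp only [wronskian, derivative_mul]
      ring
    rw [hW] at this
    exact (mul_eq_zero.mp this.symm).resolve_left (pow_ne_zero _ hg0)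
  obtain ⟨hu', hv'⟩ := huv.wronskian_eq_zero_iff.mp hWuv
  obtain ⟨a, ha⟩ : ∃ a, u = C a := ⟨_, eq_C_of_natDegree_eq_zero (derivative_eq_zero.mp hu')⟩
  obtain ⟨b, hb⟩ : ∃ b, v = C b := ⟨_, eq_C_of_natDegree_eq_zero (derivative_eq_zero.mp hv')⟩
  have hab : a ≠ 0 ∨ b ≠ 0 := by
    rw [ha, hb] at huv
    by_contra! hcon
    rw [hcon.1, hcon.2, C_0, isCoprime_zero_left] at huv
    exact not_isUnit_zero huv
  have hgdeg : g.degree < (7 * R.card * s : ℕ) := by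
    rcases hpq with h0 | h0
    · exact (degree_le_of_dvd ⟨u, hu⟩ h0).trans_lt hp
    · exact (degree_le_of_dvd ⟨v, hv⟩ h0).trans_lt hq
  have hone : (R.filter fun β => a - β * b = 0).card ≤ 1 := by
    rw [Finset.card_le_one]
    intro x hx y hy
    simp only [Finset.mem_filter] at hx hy
    have hb0 : b ≠ 0 := by
      rintro rfl
      simp only [mul_zero, sub_zero] at hx
      exact hab.elim (· hx.2) (· rfl)
    apply mul_right_cancel₀ hb0
    linear_combination hy.2 - hx.2
  have hcard := Finset.card_filter_add_card_filter_not (s := R) (fun β => a - β * b = 0)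
  have hprod : ∏ β ∈ R.filter (fun β => ¬ (a - β * b = 0)), (X - C β) ^ (12 * s) ∣ g := by
    refine Finset.prod_dvd_of_coprime ?_ ?_
    · intro x _ y _ hxy
      exact (pairwise_coprime_X_sub_C Function.injective_id hxy).pow
    · intro β hβ
      rw [Finset.mem_filter] at hβ
      have h1 := hdvd β hβ.1
      have h2 : p - C β * q = g * C (a - β * b) := by
        rw [hu, hv, ha, hb, C_sub, C_mul]
        ring
      rw [h2] at h1
      exact (isUnit_C.mpr (IsUnit.mk0 _ hβ.2)).dvd_mul_right.mp h1
  have hd := degree_le_of_dvd hprod hg0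
  rw [degree_prod] at hd
  simp only [degree_pow, degree_X_sub_C, Finset.sum_const, nsmul_eq_mul, mul_one] at hd
  have h3 := hd.trans_lt hgdeg
  have h4 : (R.filter (fun β => ¬ (a - β * b = 0))).card * (12 * s) < 7 * R.card * s := by
    exact_mod_cast h3
  have h5 : R.card ≤ (R.filter (fun β => ¬ (a - β * b = 0))).card + 1 := by omega
  have h6 : 7 * R.card ≤ (R.filter (fun β => ¬ (a - β * b = 0))).card * 12 := by omega
  have h7 := Nat.mul_le_mul_right s h6
  rw [mul_assoc _ 12 s] at h7
  omega

lemma isPrimitive_linear (r : ℚ) : (C (r.den : ℤ) * X - C r.num : ℤ[X]).IsPrimitive := by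
  intro c hc
  rw [C_dvd_iff_dvd_coeff] at hc
  have h0 := hc 0
  have h1 := hc 1
  simp only [coeff_sub, coeff_C_mul, coeff_X_zero, coeff_C_zero, mul_zero, zero_sub, dvd_neg] at h0
  simp only [coeff_sub, coeff_C_mul, coeff_X_one, mul_one, coeff_C, one_ne_zero, if_false, sub_zero] at h1
  have hcop : IsCoprime (r.num) (r.den : ℤ) := by
    rw [Int.isCoprime_iff_nat_coprime]
    simpa using r.reduced
  exact hcop.isUnit_of_dvd' h0 h1

lemma den_pow_dvd_leadingCoeff (W : ℤ[X]) (r : ℚ) (m : ℕ)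
    (h : (X - C r) ^ m ∣ W.map (Int.castRingHom ℚ)) : (r.den : ℤ) ^ m ∣ W.leadingCoeff := by
  have hprim : ((C (r.den : ℤ) * X - C r.num : ℤ[X]) ^ m).IsPrimitive := by
    induction m with
    | zero => simp
    | succ m ih =>
      rw [pow_succ]
      exact (ih ((pow_dvd_pow _ (Nat.le_succ m)).trans h)).mul (isPrimitive_linear r)
  have hden : (r.den : ℚ) ≠ 0 := by exact_mod_cast r.den_nz
  have hmap : (C (r.den : ℤ) * X - C r.num : ℤ[X]).map (Int.castRingHom ℚ) = C (r.den : ℚ) * (X - C r) := by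
    simp only [Polynomial.map_sub, Polynomial.map_mul, map_C, map_X, mul_sub, ← C_mul]
    congr 2
    simp [mul_comm, Rat.mul_den_eq_num]
  have hdvd : (C (r.den : ℤ) * X - C r.num : ℤ[X]) ^ m ∣ W := by
    rw [IsPrimitive.Int.dvd_iff_map_cast_dvd_map_cast _ _ hprim, Polynomial.map_pow, hmap, mul_pow,
      ← C_pow]
    exact (isUnit_C.mpr (IsUnit.mk0 _ (pow_ne_zero _ hden))).mul_left_dvd.mpr h
  obtain ⟨V, rfl⟩ := hdvd
  rw [leadingCoeff_mul, leadingCoeff_pow]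
  have : (C (r.den : ℤ) * X - C r.num : ℤ[X]).leadingCoeff = r.den := by
    rw [sub_eq_add_neg, ← C_neg]
    exact leadingCoeff_linear (by exact_mod_cast r.den_nz)
  rw [this]
  exact dvd_mul_right _ _

lemma wronskian_coeff_le (P Q : ℤ[X]) (N H : ℕ) (hP : P.degree < N) (hQ : Q.degree < N)
    (hPc : ∀ i, |P.coeff i| ≤ H) (hQc : ∀ i, |Q.coeff i| ≤ H) :
    |(wronskian P Q).leadingCoeff| ≤ 4 * N ^ 2 * H ^ 2 := by
  by_cases hW : wronskian P Q = 0
  · rw [hW]; simp; positivity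
  have hdeg := natDegree_wronskian_lt_add hW
  have hP0 : P ≠ 0 := by rintro rfl; simp at hW
  have hQ0 : Q ≠ 0 := by rintro rfl; simp at hW
  rw [← natDegree_lt_iff_degree_lt hP0] at hP
  rw [← natDegree_lt_iff_degree_lt hQ0] at hQ
  have hder : ∀ U : ℤ[X], U.natDegree < N → (∀ i, |U.coeff i| ≤ H) →
      ∀ i, |(derivative U).coeff i| ≤ N * H := by
    intro U hU hUc i
    rw [coeff_derivative]
    by_cases hi : i + 1 < N
    · rw [abs_mul, mul_comm]
      refine mul_le_mul ?_ (hUc _) (abs_nonneg _) (by positivity)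
      rw [abs_of_nonneg (by positivity)]
      exact_mod_cast hi.le
    · rw [coeff_eq_zero_of_natDegree_lt (by omega)]
      simp only [zero_mul, abs_zero]
      positivity
  have hmul : ∀ U V : ℤ[X], ∀ a b : ℤ, 0 ≤ a → (∀ i, |U.coeff i| ≤ a) → (∀ i, |V.coeff i| ≤ b) →
      ∀ n, |(U * V).coeff n| ≤ (n + 1) * (a * b) := by
    intro U V a b ha hU hV n
    rw [coeff_mul]
    refine (Finset.abs_sum_le_sum_abs _ _).trans ?_
    refine (Finset.sum_le_card_nsmul _ _ (a * b) ?_).trans ?_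
    · intro x _
      rw [abs_mul]
      exact mul_le_mul (hU _) (hV _) (abs_nonneg _) ha
    · simp
  rw [leadingCoeff]
  set n := (wronskian P Q).natDegree
  rw [wronskian, coeff_sub]
  refine (abs_sub _ _).trans ?_
  have h1 := hmul P (derivative Q) H (N * H) (by positivity) hPc (hder Q hQ hQc) n
  have h2 := hmul (derivative P) Q (N * H) H (by positivity) (hder P hP hPc) hQc n
  have hn : (n : ℤ) + 1 ≤ 2 * N := by omega
  calc _ ≤ ((n : ℤ) + 1) * (H * (N * H)) + (n + 1) * (N * H * H) := add_le_add h1 h2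
    _ = (n + 1) * (2 * N * H ^ 2) := by ring
    _ ≤ (2 * N) * (2 * N * H ^ 2) := mul_le_mul_of_nonneg_right hn (by positivity)
    _ = _ := by ring

/-- The index of `P(X) - r₂ Q(X)` at `r₁` is small when the Wronskian of `P` and `Q` does not vanish. -/
lemma index_bound (P Q : ℤ[X]) (N H : ℕ) (hP : P.degree < N) (hQ : Q.degree < N)
    (hPc : ∀ i, |P.coeff i| ≤ H) (hQc : ∀ i, |Q.coeff i| ≤ H) (hW : wronskian P Q ≠ 0) (r₁ r₂ : ℚ) :
    ∃ t : ℕ, r₁.den ^ (t - 1) ≤ 4 * N ^ 2 * H ^ 2 ∧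
      (hasseDeriv t (P.map (Int.castRingHom ℚ) - C r₂ * Q.map (Int.castRingHom ℚ))).eval r₁ ≠ 0 := by
  set p := P.map (Int.castRingHom ℚ) with hp
  set q := Q.map (Int.castRingHom ℚ) with hq
  have hWmap : (wronskian P Q).map (Int.castRingHom ℚ) = wronskian (p - C r₂ * q) q := by
    simp only [wronskian, Polynomial.map_sub, Polynomial.map_mul, derivative_map, derivative_sub,
      derivative_C_mul, hp, hq]
    ring
  set L := p - C r₂ * q with hL
  have hW' : wronskian L q ≠ 0 := by
    rw [← hWmap]
    exact (Polynomial.map_ne_zero_iff (RingHom.injective_int _)).mpr hW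
  have hL0 : L ≠ 0 := by
    intro h0
    rw [h0] at hW'
    simp at hW'
  refine ⟨rootMultiplicity r₁ L, ?_, ?_⟩
  · have hd : (X - C r₁) ^ (rootMultiplicity r₁ L - 1) ∣ (wronskian P Q).map (Int.castRingHom ℚ) := by
      rw [hWmap]
      have h1 := pow_rootMultiplicity_dvd L r₁
      refine dvd_sub (Dvd.dvd.mul_right ((pow_dvd_pow _ (Nat.sub_le _ _)).trans h1) _)
        (Dvd.dvd.mul_right (pow_sub_one_dvd_derivative_of_pow_dvd h1) _)
    have h2 := Int.le_of_dvd (abs_pos.mpr (leadingCoeff_ne_zero.mpr hW))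
      ((dvd_abs _ _).mpr (den_pow_dvd_leadingCoeff _ _ _ hd))
    have h3 := h2.trans (wronskian_coeff_le P Q N H hP hQ hPc hQc)
    exact_mod_cast h3
  · rw [← taylor_coeff]
    intro h0
    have h1 : (X - C r₁) ^ (rootMultiplicity r₁ L + 1) ∣ L := by
      rw [X_sub_C_pow_dvd_iff, ← taylor_apply, X_pow_dvd_iff]
      intro d hd
      have h2 := pow_rootMultiplicity_dvd L r₁
      rw [X_sub_C_pow_dvd_iff, ← taylor_apply, X_pow_dvd_iff] at h2
      rcases Nat.lt_succ_iff_lt_or_eq.mp hd with h | h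
      · exact h2 d h
      · rw [h]; exact h0
    have := (le_rootMultiplicity_iff hL0).mpr h1
    omega

lemma eval_hasseDeriv (U : ℂ[X]) (N : ℕ) (hU : U.degree < N) (t : ℕ) (z : ℂ) :
    (hasseDeriv t U).eval z = ∑ i ∈ Finset.range N, (Nat.choose i t : ℂ) * U.coeff i * z ^ (i - t) := by
  have h : U = ∑ i ∈ Finset.range N, monomial i (U.coeff i) := by
    ext n
    simp only [finsetSum_coeff, coeff_monomial, Finset.sum_ite_eq', Finset.mem_range]
    split_ifs with hn
    · rfl
    · exact (degree_lt_iff_coeff_zero _ _).mp hU n (by omega)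
  conv_lhs => rw [h]
  simp only [map_sum, hasseDeriv_monomial, eval_finsetSum, eval_monomial]

lemma norm_eval_hasseDeriv_le (U : ℂ[X]) (N : ℕ) (hU : U.degree < N) (M A : ℝ)
    (hM : ∀ i, ‖U.coeff i‖ ≤ M) (hA : 1 ≤ A) (t : ℕ) (z : ℂ) (hz : ‖z‖ ≤ A) :
    ‖(hasseDeriv t U).eval z‖ ≤ N * 2 ^ N * A ^ N * M := by
  rw [eval_hasseDeriv U N hU]
  refine (norm_sum_le _ _).trans ((Finset.sum_le_card_nsmul _ _ (2 ^ N * M * A ^ N) ?_).trans_eq ?_)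
  · intro i hi
    rw [Finset.mem_range] at hi
    rw [norm_mul, norm_mul, norm_pow, Complex.norm_natCast]
    have hM0 := (norm_nonneg _).trans (hM 0)
    have h1 : (Nat.choose i t : ℝ) ≤ 2 ^ N := by
      exact_mod_cast (Nat.choose_le_two_pow i t).trans (Nat.pow_le_pow_right (by norm_num) hi.le)
    have h2 : ‖z‖ ^ (i - t) ≤ A ^ N :=
      (pow_le_pow_left₀ (norm_nonneg _) hz _).trans (pow_le_pow_right₀ hA (by omega))
    gcongr
    exact hM i
  · simp; ring

lemma norm_eval_hasseDeriv_le_of_coeff_eq_zero (U : ℂ[X]) (N k : ℕ) (hU : U.degree < N) (M : ℝ)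
    (hM : ∀ i, ‖U.coeff i‖ ≤ M) (hk : ∀ i < k, U.coeff i = 0) (t : ℕ) (z : ℂ) (hz : ‖z‖ ≤ 1) :
    ‖(hasseDeriv t U).eval z‖ ≤ ‖z‖ ^ (k - t) * (N * 2 ^ N * M) := by
  rw [eval_hasseDeriv U N hU]
  refine (norm_sum_le _ _).trans
    ((Finset.sum_le_card_nsmul _ _ (2 ^ N * M * ‖z‖ ^ (k - t)) ?_).trans_eq ?_)
  · intro i hi
    rw [Finset.mem_range] at hi
    have hM0 := (norm_nonneg _).trans (hM 0)
    by_cases hik : i < k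
    · rw [hk i hik]
      simp only [mul_zero, zero_mul, norm_zero]
      positivity
    rw [norm_mul, norm_mul, norm_pow, Complex.norm_natCast]
    have h1 : (Nat.choose i t : ℝ) ≤ 2 ^ N := by
      exact_mod_cast (Nat.choose_le_two_pow i t).trans (Nat.pow_le_pow_right (by norm_num) hi.le)
    have h2 : ‖z‖ ^ (i - t) ≤ ‖z‖ ^ (k - t) := pow_le_pow_of_le_one (norm_nonneg _) hz (by omega)
    gcongr
    exact hM i
  · simp; ring

/-- A rational with denominator dividing `b ^ N * c` that is nonzero is at least `1 / (b ^ N * c)`. -/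
lemma one_le_of_eval_ne_zero (P Q : ℤ[X]) (N : ℕ) (hP : P.degree < N) (hQ : Q.degree < N)
    (t : ℕ) (r₁ r₂ : ℚ)
    (h : (hasseDeriv t (P.map (Int.castRingHom ℚ) - C r₂ * Q.map (Int.castRingHom ℚ))).eval r₁ ≠ 0) :
    1 ≤ (r₁.den : ℝ) ^ N * r₂.den * ‖(hasseDeriv t (P.map (Int.castRingHom ℂ) -
      C (r₂ : ℂ) * Q.map (Int.castRingHom ℂ))).eval (r₁ : ℂ)‖ := by
  have hcast : (hasseDeriv t (P.map (Int.castRingHom ℂ) -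
      C (r₂ : ℂ) * Q.map (Int.castRingHom ℂ))).eval (r₁ : ℂ) =
      (((hasseDeriv t (P.map (Int.castRingHom ℚ) - C r₂ * Q.map (Int.castRingHom ℚ))).eval r₁ : ℚ) : ℂ) := by
    have e : P.map (Int.castRingHom ℂ) - C (r₂ : ℂ) * Q.map (Int.castRingHom ℂ) =
      (P.map (Int.castRingHom ℚ) - C r₂ * Q.map (Int.castRingHom ℚ)).map (Rat.castHom ℂ) := by
      rw [Polynomial.map_sub, Polynomial.map_mul, map_C, Polynomial.map_map, Polynomial.map_map]
      congr
    rw [e, ← taylor_coeff, ← taylor_coeff]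
    change (taylor ((Rat.castHom ℂ) r₁) _).coeff t = (Rat.castHom ℂ) _
    rw [← map_taylor, coeff_map]
  rw [hcast]
  set v := (hasseDeriv t (P.map (Int.castRingHom ℚ) - C r₂ * Q.map (Int.castRingHom ℚ))).eval r₁ with hv
  have hclear : ∀ U : ℤ[X], U.degree < N → ∃ z : ℤ,
      (r₁.den : ℚ) ^ N * (hasseDeriv t (U.map (Int.castRingHom ℚ))).eval r₁ = z := by
    intro U hU
    have hdeg : (hasseDeriv t U).natDegree ≤ N := by
      refine (natDegree_hasseDeriv_le U t).trans ((Nat.sub_le _ _).trans ?_)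
      exact natDegree_le_of_degree_le hU.le
    refine ⟨∑ i ∈ Finset.range (N + 1), (hasseDeriv t U).coeff i * (r₁.num ^ i * (r₁.den : ℤ) ^ (N - i)), ?_⟩
    have e : hasseDeriv t (U.map (Int.castRingHom ℚ)) = (hasseDeriv t U).map (Int.castRingHom ℚ) := by
      ext n
      simp [hasseDeriv_coeff]
    rw [e, eval_map, eval₂_eq_sum_range' _ (Nat.lt_succ_of_le hdeg), Finset.mul_sum]
    push_cast
    refine Finset.sum_congr rfl fun i hi => ?_
    rw [Finset.mem_range] at hi
    have hden : (r₁.den : ℚ) ≠ 0 := by exact_mod_cast r₁.den_nz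
    obtain ⟨j, hj⟩ : ∃ j, N = i + j := ⟨N - i, by omega⟩
    have hr : (r₁.num : ℚ) = r₁ * r₁.den := (Rat.mul_den_eq_num r₁).symm
    rw [hj, Nat.add_sub_cancel_left, hr, eq_intCast]
    ring
  obtain ⟨a, ha⟩ := hclear P hP
  obtain ⟨b, hb⟩ := hclear Q hQ
  have hz : (r₁.den : ℚ) ^ N * r₂.den * v = ((a * r₂.den - r₂.num * b : ℤ) : ℚ) := by
    rw [hv, ← smul_eq_C_mul, map_sub, map_smul, eval_sub, eval_smul, smul_eq_mul]
    push_cast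
    rw [← ha, ← hb, ← Rat.mul_den_eq_num r₂]
    ring
  have hden1 : (r₁.den : ℚ) ≠ 0 := by exact_mod_cast r₁.den_nz
  have hden2 : (r₂.den : ℚ) ≠ 0 := by exact_mod_cast r₂.den_nz
  have hne : (a * r₂.den - r₂.num * b : ℤ) ≠ 0 := by
    intro h0
    rw [h0, Int.cast_zero] at hz
    exact mul_ne_zero (mul_ne_zero (pow_ne_zero _ hden1) hden2) h hz
  have h1 : (1 : ℝ) ≤ |((a * r₂.den - r₂.num * b : ℤ) : ℝ)| := by
    exact_mod_cast Int.one_le_abs hne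
  calc (1 : ℝ) ≤ _ := h1
    _ = |(((r₁.den : ℚ) ^ N * r₂.den * v : ℚ) : ℝ)| := by rw [hz]; push_cast; rfl
    _ = _ := by
      push_cast
      rw [abs_mul, abs_mul, abs_pow, Nat.abs_cast, Nat.abs_cast]
      congr 1
      rw [← Complex.norm_ratCast]

lemma thue_upper_bound (P Q : ℤ[X]) (N k H : ℕ) (hP : P.degree < N) (hQ : Q.degree < N)
    (hPc : ∀ i, |P.coeff i| ≤ H) (hQc : ∀ i, |Q.coeff i| ≤ H) (β : ℂ)
    (hdvd : (X - C β) ^ k ∣ P.map (Int.castRingHom ℂ) - C β * Q.map (Int.castRingHom ℂ))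
    (t : ℕ) (x y : ℂ) (hx : ‖x - β‖ ≤ 1) :
    ‖(hasseDeriv t (P.map (Int.castRingHom ℂ) - C y * Q.map (Int.castRingHom ℂ))).eval x‖ ≤
      (N * 2 ^ N) ^ 2 * (‖β‖ + 1) ^ (N + 1) * H * (‖x - β‖ ^ (k - t) + ‖y - β‖) := by
  set p := P.map (Int.castRingHom ℂ) with hp
  set q := Q.map (Int.castRingHom ℂ) with hq
  set A := ‖β‖ + 1 with hA
  have hA1 : 1 ≤ A := by rw [hA]; linarith [norm_nonneg β]
  have hpd : p.degree < N := degree_map_le.trans_lt hP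
  have hqd : q.degree < N := degree_map_le.trans_lt hQ
  have hpc : ∀ i, ‖p.coeff i‖ ≤ H := by
    intro i
    rw [hp, coeff_map, eq_intCast, Complex.norm_intCast]
    exact_mod_cast hPc i
  have hqc : ∀ i, ‖q.coeff i‖ ≤ H := by
    intro i
    rw [hq, coeff_map, eq_intCast, Complex.norm_intCast]
    exact_mod_cast hQc i
  have hVd : (p - C β * q).degree < N := by
    refine (degree_sub_le _ _).trans_lt (max_lt hpd ?_)
    rw [← smul_eq_C_mul]
    exact (degree_smul_le _ _).trans_lt hqd
  have hVc : ∀ i, ‖(p - C β * q).coeff i‖ ≤ A * H := by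
    intro i
    rw [coeff_sub, coeff_C_mul]
    refine (norm_sub_le _ _).trans ?_
    rw [norm_mul]
    have := mul_le_mul_of_nonneg_left (hqc i) (norm_nonneg β)
    have := hpc i
    rw [hA]
    linarith
  have hT : ∀ i, ‖(taylor β (p - C β * q)).coeff i‖ ≤ N * 2 ^ N * A ^ N * (A * H) := by
    intro i
    rw [taylor_coeff]
    exact norm_eval_hasseDeriv_le _ N hVd _ A hVc hA1 i β (by rw [hA]; linarith)
  have hTd : (taylor β (p - C β * q)).degree < N := by rw [degree_taylor]; exact hVd
  rw [X_sub_C_pow_dvd_iff, ← taylor_apply, X_pow_dvd_iff] at hdvd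
  have h1 := norm_eval_hasseDeriv_le_of_coeff_eq_zero _ N k hTd _ hT hdvd t (x - β) hx
  rw [← taylor_coeff, taylor_taylor, sub_add_cancel, taylor_coeff] at h1
  have h2 := norm_eval_hasseDeriv_le q N hqd H A hqc hA1 t x (by
    have := norm_add_le (x - β) β
    rw [sub_add_cancel] at this
    rw [hA]; linarith)
  have e : p - C y * q = (p - C β * q) - (y - β) • q := by
    rw [smul_eq_C_mul, C_sub]; ring
  rw [e, map_sub, map_smul, eval_sub, eval_smul, smul_eq_mul]
  refine (norm_sub_le _ _).trans ?_
  rw [norm_mul]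
  have hN : (N : ℝ) * 2 ^ N * A ^ N * H ≤ (N * 2 ^ N) ^ 2 * A ^ (N + 1) * H := by
    rcases Nat.eq_zero_or_pos N with h0 | h0
    · simp [h0]
    · have : (1 : ℝ) ≤ N * 2 ^ N := by
        have h3 : (1 : ℝ) ≤ N := by exact_mod_cast h0
        have h4 : (1 : ℝ) ≤ 2 ^ N := one_le_pow₀ (by norm_num)
        nlinarith
      gcongr
      · exact le_self_pow₀ this (by norm_num)
      omega
  have h3 := mul_le_mul_of_nonneg_left (h2.trans hN) (norm_nonneg (y - β))
  calc _ ≤ _ := add_le_add h1 h3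
    _ = _ := by ring

/-- The numerical contradiction in Thue's method. -/
lemma thue_numeric (D s t q₁ q₂ : ℕ) (K L : ℝ) (hD : 3 ≤ D) (hs : 20 ≤ s) (hK : 1 ≤ K) (hL : 1 ≤ L)
    (hq₁ : K ^ 8 < q₁) (h12 : q₁ ^ (12 * s) ≤ q₂) (h21 : q₂ ≤ q₁ ^ (12 * (s + 1)))
    (ht : (q₁ : ℝ) ^ (t - 1) ≤ K ^ s)
    (h : 1 ≤ (q₁ : ℝ) ^ (7 * D * s) * q₂ * (K ^ s * ((L / q₁ ^ D) ^ (12 * s - t) + L / q₂ ^ D))) :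
    q₁ ≤ 2 * K * L ^ 12 := by
  have hq1 : (1 : ℝ) < q₁ := (one_le_pow₀ hK).trans_lt hq₁
  have hq0 : (0 : ℝ) < q₁ := by linarith
  have ht8 : 8 * (t - 1) ≤ s := by
    by_contra! hcon
    have h1 : (q₁ : ℝ) ^ (8 * (t - 1)) ≤ (K ^ 8) ^ s := by
      rw [mul_comm, pow_mul, pow_right_comm K 8 s]
      exact pow_le_pow_left₀ (by positivity) ht 8
    have h2 : (K ^ 8) ^ s < (q₁ : ℝ) ^ s := pow_lt_pow_left₀ hq₁ (by positivity) (by omega)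
    have h3 : (q₁ : ℝ) ^ s ≤ q₁ ^ (8 * (t - 1)) := pow_le_pow_right₀ hq1.le hcon.le
    linarith
  have hts : t ≤ 12 * s := by omega
  have hq2 : (q₁ : ℝ) ^ (12 * s) ≤ q₂ := by exact_mod_cast h12
  have hq2' : (q₂ : ℝ) ≤ q₁ ^ (12 * (s + 1)) := by exact_mod_cast h21
  have hL12 : L ≤ L ^ (12 * s) := le_self_pow₀ hL (by omega)
  have e1 : (L / q₁ ^ D) ^ (12 * s - t) ≤ L ^ (12 * s) / q₁ ^ (D * (12 * s - t)) := by
    rw [div_pow, ← pow_mul]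
    gcongr
    omega
  have e2 : L / q₂ ^ D ≤ L ^ (12 * s) / q₁ ^ (D * (12 * s - t)) := by
    have : (q₁ : ℝ) ^ (D * (12 * s - t)) ≤ (q₂ : ℝ) ^ D := by
      refine le_trans ?_ (pow_le_pow_left₀ (by positivity) hq2 D)
      rw [← pow_mul, mul_comm D]
      exact pow_le_pow_right₀ hq1.le (Nat.mul_le_mul_right _ (Nat.sub_le _ _))
    gcongr
  have hpow : (q₁ : ℝ) ^ (D * (12 * s - t)) ≤
      q₁ ^ (7 * D * s) * q₁ ^ (12 * (s + 1)) * (K ^ s * (2 * L ^ (12 * s))) := by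
    have hpos : (0 : ℝ) < q₁ ^ (D * (12 * s - t)) := by positivity
    have : 1 ≤ (q₁ : ℝ) ^ (7 * D * s) * q₁ ^ (12 * (s + 1)) * (K ^ s *
        (L ^ (12 * s) / q₁ ^ (D * (12 * s - t)) + L ^ (12 * s) / q₁ ^ (D * (12 * s - t)))) := by
      refine h.trans ?_
      gcongr
    calc _ = _ * (1 : ℝ) := (mul_one _).symm
      _ ≤ _ := mul_le_mul_of_nonneg_left this hpos.le
      _ = _ := by field_simp; ring
  have hexp : 7 * D * s + 12 * (s + 1) + s ≤ D * (12 * s - t) := by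
    obtain ⟨u, hu⟩ : ∃ u, 12 * s - t = 7 * s + u := ⟨5 * s - t, by omega⟩
    have hu' : 13 * s + 12 ≤ 3 * u := by omega
    rw [hu]
    nlinarith [Nat.mul_le_mul_right u hD]
  have h5 : (q₁ : ℝ) ^ s ≤ (2 * K * L ^ 12) ^ s := by
    have h6 : (q₁ : ℝ) ^ (7 * D * s) * q₁ ^ (12 * (s + 1)) * q₁ ^ s ≤
        q₁ ^ (7 * D * s) * q₁ ^ (12 * (s + 1)) * (K ^ s * (2 * L ^ (12 * s))) := by
      rw [← pow_add, ← pow_add]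
      refine (pow_le_pow_right₀ hq1.le hexp).trans ?_
      rw [pow_add]
      exact hpow
    refine (le_of_mul_le_mul_left h6 (by positivity)).trans ?_
    rw [mul_pow, mul_pow, ← pow_mul]
    have : (2 : ℝ) ≤ 2 ^ s := le_self_pow₀ (by norm_num) (by omega)
    calc K ^ s * (2 * L ^ (12 * s)) = 2 * K ^ s * L ^ (12 * s) := by ring
      _ ≤ _ := by gcongr
  exact le_of_pow_le_pow_left₀ (by omega) (by positivity) h5

lemma finite_rat_of_bounded (M : ℝ) (K : ℕ) : {r : ℚ | |(r : ℝ)| ≤ M ∧ r.den ≤ K}.Finite := by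
  refine Set.Finite.of_finite_image (f := fun r : ℚ => (r.num, r.den)) ?_ ?_
  · refine ((Set.finite_Icc (-⌈M * K⌉) ⌈M * K⌉).prod (Set.finite_Iic K)).subset ?_
    rintro _ ⟨r, ⟨h1, h2⟩, rfl⟩
    refine ⟨abs_le.mp ?_, h2⟩
    have h3 : (r.num : ℝ) = r * r.den := by exact_mod_cast (Rat.mul_den_eq_num r).symm
    have h4 : (|r.num| : ℝ) ≤ M * K := by
      rw [h3, abs_mul, Nat.abs_cast]
      have : (r.den : ℝ) ≤ K := by exact_mod_cast h2
      have := (abs_nonneg _).trans h1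
      gcongr
    exact_mod_cast h4.trans (Int.le_ceil _)
  · intro r _ r' _ h
    simp only [Prod.mk.injEq] at h
    exact Rat.ext h.1 h.2

/-- Thue's theorem: a root of a separable integral polynomial of degree `D ≥ 3` has
only finitely many rational approximations within `L / den ^ D`. -/
theorem finite_approximations (h : ℤ[X]) (R : Finset ℂ) (hR : ∀ β ∈ R, aeval β h = 0)
    (hcard : R.card = h.natDegree) (hD : 3 ≤ h.natDegree) (β : ℂ) (hβ : β ∈ R) (L : ℝ) :
    {r : ℚ | ‖(r : ℂ) - β‖ ≤ L / r.den ^ h.natDegree}.Finite := by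
  wlog hL : 1 ≤ L generalizing L
  · refine (this 1 le_rfl).subset fun r hr => ?_
    rw [Set.mem_ofPred_eq] at hr ⊢
    push Not at hL
    exact hr.trans (by gcongr)
  set D := h.natDegree with hDdef
  obtain ⟨C₀, hC₀, haux⟩ := exists_aux h (by omega)
  set A := ‖β‖ + 1 with hA
  have hA1 : 1 ≤ A := by rw [hA]; linarith [norm_nonneg β]
  have hC₀1 : (1 : ℝ) ≤ C₀ := by exact_mod_cast hC₀
  obtain ⟨K, hK1, hKa, hKb⟩ : ∃ K : ℝ, 1 ≤ K ∧ (2 ^ (2 + 14 * D) * C₀ ^ 2 : ℝ) ≤ K ∧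
      2 ^ (28 * D) * A ^ (14 * D) * C₀ ≤ K :=
    ⟨2 ^ (2 + 14 * D) * C₀ ^ 2 + 2 ^ (28 * D) * A ^ (14 * D) * C₀, by
      have h1 : (1 : ℝ) ≤ 2 ^ (2 + 14 * D) := one_le_pow₀ (by norm_num)
      have h2 : (1 : ℝ) ≤ (C₀ : ℝ) ^ 2 := one_le_pow₀ hC₀1
      have h3 : 0 ≤ 2 ^ (28 * D) * A ^ (14 * D) * C₀ := by positivity
      nlinarith, by
      have h3 : 0 ≤ 2 ^ (28 * D) * A ^ (14 * D) * C₀ := by positivity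
      linarith, by
      have h3 : (0 : ℝ) ≤ 2 ^ (2 + 14 * D) * C₀ ^ 2 := by positivity
      linarith⟩
  have hunbdd : ∀ S : Set ℚ, S ⊆ {r : ℚ | ‖(r : ℂ) - β‖ ≤ L / r.den ^ D} → ¬ S.Finite →
      ∀ B : ℕ, ∃ r ∈ S, B < r.den := by
    intro S hS hinf B
    by_contra! hcon
    refine hinf ((finite_rat_of_bounded (L + ‖β‖) B).subset fun r hr => ⟨?_, hcon r hr⟩)
    have h1 : ‖(r : ℂ) - β‖ ≤ L := by
      refine (hS hr).trans (div_le_self (by linarith) ?_)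
      exact one_le_pow₀ (by exact_mod_cast r.pos)
    have h2 := norm_add_le ((r : ℂ) - β) β
    rw [sub_add_cancel, Complex.norm_ratCast] at h2
    linarith
  by_contra hinf
  obtain ⟨r₁, hr₁, hlarge⟩ := hunbdd _ subset_rfl hinf (⌈K ^ 8⌉₊ + ⌈2 * K * L ^ 12⌉₊ + ⌈L⌉₊)
  set q₁ := r₁.den with hq₁
  obtain ⟨r₂, hr₂, hlarge₂⟩ := hunbdd _ subset_rfl hinf (q₁ ^ (12 * 20))
  set q₂ := r₂.den with hq₂
  have hlarge' : (⌈K ^ 8⌉₊ : ℝ) + ⌈2 * K * L ^ 12⌉₊ + ⌈L⌉₊ < q₁ := by exact_mod_cast hlarge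
  have hK8 := Nat.le_ceil (K ^ 8)
  have hKL := Nat.le_ceil (2 * K * L ^ 12)
  have hLL := Nat.le_ceil L
  have hK0 : 0 < K ^ 8 := by positivity
  have hKL0 : 0 < 2 * K * L ^ 12 := by positivity
  have hq1 : 1 < q₁ := by
    have : (1 : ℝ) < q₁ := by linarith
    exact_mod_cast this
  have hq1pow : 1 < q₁ ^ 12 := Nat.one_lt_pow (by norm_num) hq1
  obtain ⟨s, hs⟩ : ∃ s, s = Nat.log (q₁ ^ 12) q₂ := ⟨_, rfl⟩
  have hlo : q₁ ^ (12 * s) ≤ q₂ := by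
    rw [pow_mul, hs]
    exact Nat.pow_log_le_self _ r₂.den_nz
  have hhi : q₂ ≤ q₁ ^ (12 * (s + 1)) := by
    rw [pow_mul, hs]
    exact (Nat.lt_pow_succ_log_self hq1pow _).le
  have hs20 : 20 ≤ s := by
    rw [hs]
    refine Nat.le_log_of_pow_le hq1pow ?_
    rw [← pow_mul]
    exact hlarge₂.le
  obtain ⟨P, Q, hPQ, hP, hQ, hPc, hQc, hdvd⟩ := haux s (by omega)
  set N := 7 * D * s with hN
  have hN1 : 1 ≤ N := by rw [hN]; exact Nat.one_le_iff_ne_zero.mpr (by positivity)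
  have hW : wronskian P Q ≠ 0 := by
    have h1 := wronskian_ne_zero_of_dvd R (by omega) s (P.map (Int.castRingHom ℂ))
      (Q.map (Int.castRingHom ℂ))
      (hPQ.imp (Polynomial.map_ne_zero_iff (RingHom.injective_int _)).mpr
        (Polynomial.map_ne_zero_iff (RingHom.injective_int _)).mpr)
      (degree_map_le.trans_lt (by rwa [hcard])) (degree_map_le.trans_lt (by rwa [hcard]))
      (fun β hβ => hdvd β (hR β hβ))
    rintro h0
    apply h1
    have : wronskian (P.map (Int.castRingHom ℂ)) (Q.map (Int.castRingHom ℂ)) =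
        (wronskian P Q).map (Int.castRingHom ℂ) := by
      simp [wronskian, derivative_map]
    rw [this, h0, Polynomial.map_zero]
  have hPc' : ∀ i, |P.coeff i| ≤ ((C₀ ^ s : ℕ) : ℤ) := by exact_mod_cast hPc
  have hQc' : ∀ i, |Q.coeff i| ≤ ((C₀ ^ s : ℕ) : ℤ) := by exact_mod_cast hQc
  obtain ⟨t, ht, hne⟩ := index_bound P Q N (C₀ ^ s) hP hQ hPc' hQc' hW r₁ r₂
  have hlow := one_le_of_eval_ne_zero P Q N hP hQ t r₁ r₂ hne
  have hr₁1 : ‖(r₁ : ℂ) - β‖ ≤ 1 := by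
    refine hr₁.trans ?_
    have h1 : (1 : ℝ) ≤ q₁ := by exact_mod_cast hq1.le
    rw [div_le_one (by positivity)]
    exact le_trans (by linarith) (le_self_pow₀ h1 (by omega))
  have hup := thue_upper_bound P Q N (12 * s) (C₀ ^ s) hP hQ hPc' hQc' β (hdvd β (hR β hβ)) t
    r₁ r₂ hr₁1
  have hN2 : (N : ℝ) ≤ 2 ^ N := by exact_mod_cast Nat.lt_two_pow_self.le
  have hfinal := thue_numeric D s t q₁ q₂ K L hD hs20 hK1 hL (by linarith) hlo hhi ?_ ?_
  · linarith
  · calc (q₁ : ℝ) ^ (t - 1) ≤ 4 * N ^ 2 * (C₀ ^ s : ℕ) ^ 2 := by exact_mod_cast ht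
      _ ≤ 4 ^ s * (2 ^ N) ^ 2 * (C₀ ^ s : ℕ) ^ 2 := by
        gcongr
        exact le_self_pow₀ (by norm_num) (by omega)
      _ = (2 ^ (2 + 14 * D) * C₀ ^ 2) ^ s := by
        push_cast
        rw [hN, show (4 : ℝ) = 2 ^ 2 by norm_num]
        simp only [mul_pow, ← pow_mul, pow_add]
        ring_nf
      _ ≤ K ^ s := by gcongr
  · refine hlow.trans ?_
    refine mul_le_mul_of_nonneg_left (hup.trans ?_) (by positivity)
    have hE : ((N : ℝ) * 2 ^ N) ^ 2 * A ^ (N + 1) * (C₀ ^ s : ℕ) ≤ K ^ s := by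
      calc _ ≤ ((2 : ℝ) ^ N * 2 ^ N) ^ 2 * A ^ (2 * N) * (C₀ ^ s : ℕ) := by
            gcongr
            omega
        _ = (2 ^ (28 * D) * A ^ (14 * D) * C₀) ^ s := by
            push_cast
            rw [hN]
            simp only [mul_pow, ← pow_mul]
            ring_nf
        _ ≤ K ^ s := by gcongr
    have h1 : ‖(r₁ : ℂ) - β‖ ^ (12 * s - t) ≤ (L / q₁ ^ D) ^ (12 * s - t) :=
      pow_le_pow_left₀ (norm_nonneg _) hr₁ _
    have h2 : ‖(r₂ : ℂ) - β‖ ≤ L / q₂ ^ D := hr₂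
    gcongr

/-- Thue's theorem for binary forms: the form attached to a separable integral polynomial of
degree `D ≥ 3` takes bounded values at only finitely many coprime pairs. -/
theorem finite_small_values (h : ℤ[X]) (R : Finset ℂ) (hR : ∀ β ∈ R, aeval β h = 0)
    (hcard : R.card = h.natDegree) (hD : 3 ≤ h.natDegree) (M : ℝ) :
    {r : ℚ | ‖aeval (r : ℂ) h‖ * r.den ^ h.natDegree ≤ M}.Finite := by
  obtain ⟨δ, hδ, hsep⟩ : ∃ δ : ℝ, 0 < δ ∧ ∀ x ∈ R, ∀ y ∈ R, x ≠ y → 2 * δ ≤ ‖x - y‖ := by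
    have hne : (R.offDiag).Nonempty := by
      obtain ⟨x, hx, y, hy, hxy⟩ := Finset.one_lt_card.mp (show 1 < R.card by omega)
      exact ⟨(x, y), Finset.mem_offDiag.mpr ⟨hx, hy, hxy⟩⟩
    obtain ⟨z, hz, hmin⟩ := Finset.exists_min_image R.offDiag (fun z => ‖z.1 - z.2‖) hne
    rw [Finset.mem_offDiag] at hz
    refine ⟨‖z.1 - z.2‖ / 2, half_pos (norm_pos_iff.mpr (sub_ne_zero.mpr hz.2.2)), ?_⟩
    intro x hx y hy hxy
    have := hmin (x, y) (Finset.mem_offDiag.mpr ⟨hx, hy, hxy⟩)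
    simp only at this
    linarith
  have h0 : h ≠ 0 := by
    rintro rfl
    simp at hD
  have hlc : (h.leadingCoeff : ℂ) ≠ 0 := by
    rw [Int.cast_ne_zero]
    exact leadingCoeff_ne_zero.mpr h0
  have hmap0 : h.map (Int.castRingHom ℂ) ≠ 0 :=
    (Polynomial.map_ne_zero_iff (RingHom.injective_int _)).mpr h0
  have hnd : (h.map (Int.castRingHom ℂ)).natDegree = h.natDegree :=
    natDegree_map_eq_of_injective (RingHom.injective_int _) h
  have hroots : (h.map (Int.castRingHom ℂ)).roots = R.val := by
    symm
    apply Multiset.eq_of_le_of_card_le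
    · rw [Multiset.le_iff_subset R.nodup]
      intro β hβ
      rw [mem_roots hmap0, IsRoot, eval_map]
      exact hR β hβ
    · rw [Finset.card_val, hcard, ← hnd]
      exact card_roots' _
  have hfac : ∀ z : ℂ, aeval z h = h.leadingCoeff * ∏ β ∈ R, (z - β) := by
    intro z
    have h1 := C_leadingCoeff_mul_prod_multiset_X_sub_C (p := h.map (Int.castRingHom ℂ)) (by
      rw [hroots, Finset.card_val, hcard, hnd])
    have h2 : aeval z h = (h.map (Int.castRingHom ℂ)).eval z := by
      rw [eval_map]; rfl
    rw [h2, ← h1, hroots, eval_mul, eval_C, leadingCoeff_map_of_injective (RingHom.injective_int _)]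
    congr 1
    change (∏ β ∈ R, (X - C β)).eval z = _
    rw [eval_prod]
    simp
  refine (R.finite_toSet.biUnion fun β hβ => finite_approximations h R hR hcard hD β hβ
    (M / (‖(h.leadingCoeff : ℂ)‖ * δ ^ (h.natDegree - 1)))).subset ?_
  intro r hr
  obtain ⟨β, hβ, hmin⟩ := Finset.exists_min_image R (fun β => ‖(r : ℂ) - β‖)
    (Finset.card_pos.mp (by omega))
  refine Set.mem_biUnion hβ ?_
  rw [Set.mem_ofPred_eq]
  have hr' : ‖aeval (r : ℂ) h‖ * r.den ^ h.natDegree ≤ M := hr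
  rw [hfac, norm_mul, norm_prod, ← Finset.mul_prod_erase R _ hβ] at hr'
  have hprod : δ ^ (h.natDegree - 1) ≤ ∏ x ∈ R.erase β, ‖(r : ℂ) - x‖ := by
    rw [← hcard, ← Finset.card_erase_of_mem hβ, ← Finset.prod_const]
    refine Finset.prod_le_prod (fun _ _ => hδ.le) fun x hx => ?_
    rw [Finset.mem_erase] at hx
    have h1 := hsep x hx.2 β hβ hx.1
    have h2 := hmin x hx.2
    have h3 := norm_sub_le ((r : ℂ) - β) ((r : ℂ) - x)
    rw [sub_sub_sub_cancel_left] at h3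
    linarith
  have hden : (0 : ℝ) < r.den ^ h.natDegree := by
    have : (0 : ℝ) < r.den := by exact_mod_cast r.pos
    positivity
  have hl : 0 < ‖(h.leadingCoeff : ℂ)‖ := norm_pos_iff.mpr hlc
  rw [div_div, le_div_iff₀ (by positivity)]
  calc _ = ‖(h.leadingCoeff : ℂ)‖ * (‖(r : ℂ) - β‖ * δ ^ (h.natDegree - 1)) * r.den ^ h.natDegree := by ring
    _ ≤ _ := by gcongr
    _ ≤ M := hr'

/-- The value at `(u, v)` of the binary form of degree `d` attached to the polynomial `p`. -/
noncomputable def homogEval {R A : Type*} [CommSemiring R] [CommSemiring A] [Algebra R A] (d : ℕ)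
    (p : R[X]) (u v : A) : A :=
  ∑ i ∈ Finset.range (d + 1), algebraMap R A (p.coeff i) * u ^ i * v ^ (d - i)

section homogEval

variable {R A B : Type*} [CommSemiring R] [CommSemiring A] [Algebra R A] [CommSemiring B]
  [Algebra R B]

lemma map_homogEval (φ : A →ₐ[R] B) (d : ℕ) (p : R[X]) (u v : A) :
    φ (homogEval d p u v) = homogEval d p (φ u) (φ v) := by
  simp [homogEval, map_sum]

lemma homogEval_zero_right (d : ℕ) (p : R[X]) (u : A) :
    homogEval d p u 0 = algebraMap R A (p.coeff d) * u ^ d := by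
  rw [homogEval, Finset.sum_range_succ, Finset.sum_eq_zero]
  · simp
  · intro i hi
    rw [Finset.mem_range] at hi
    rw [zero_pow (by omega), mul_zero]

lemma homogEval_of_ne_zero {K : Type*} [Field K] [Algebra R K] (d : ℕ) (p : R[X])
    (hp : p.natDegree ≤ d) (u v : K) (hv : v ≠ 0) :
    homogEval d p u v = v ^ d * aeval (u / v) p := by
  rw [homogEval, aeval_eq_sum_range' (Nat.lt_succ_of_le hp), Finset.mul_sum]
  refine Finset.sum_congr rfl fun i hi => ?_
  rw [Finset.mem_range] at hi
  rw [Algebra.smul_def, div_pow]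
  have : v ^ d = v ^ i * v ^ (d - i) := by rw [← pow_add]; congr 1; omega
  rw [this]
  field_simp

lemma dvd_homogEval_sub (d : ℕ) (p : ℤ[X]) (a b : ℤ) :
    b ∣ homogEval d p a b - p.coeff d * a ^ d := by
  rw [homogEval, Finset.sum_range_succ]
  simp only [algebraMap_int_eq, eq_intCast, Int.cast_id, Nat.sub_self, pow_zero, mul_one,
    add_sub_cancel_right]
  refine Finset.dvd_sum fun i hi => ?_
  rw [Finset.mem_range] at hi
  exact (dvd_pow_self b (by omega)).mul_left _

lemma homogEval_num_den (d : ℕ) (p : ℤ[X]) (hp : p.natDegree ≤ d) (r : ℚ) :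
    ((homogEval d p r.num (r.den : ℤ) : ℤ) : ℚ) = (r.den : ℚ) ^ d * aeval r p := by
  have h := map_homogEval (Algebra.ofId ℤ ℚ) d p r.num r.den
  simp only [eq_intCast, Int.cast_natCast] at h
  rw [h, homogEval_of_ne_zero d p hp _ _ (by exact_mod_cast r.den_ne_zero), Rat.num_div_den]

end homogEval

/-- The denominator form divides a fixed integer at every rational point where the fraction
`F / G` takes an integral value. -/
lemma exists_homogEval_dvd (F G U V : ℤ[X]) (c : ℤ) (hc : c ≠ 0) (hUV : U * F + V * G = C c)
    (n : ℕ) (hF : F.natDegree ≤ n) (hG : G.natDegree ≤ n) (hlead : F.coeff n ≠ 0 ∨ G.coeff n ≠ 0) :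
    ∃ M : ℤ, M ≠ 0 ∧ ∀ r : ℚ, ∀ k : ℤ, aeval r F = k * aeval r G →
      homogEval n G r.num (r.den : ℤ) ∣ M := by
  set N := max U.natDegree V.natDegree with hN
  obtain ⟨l, hl, hlFG⟩ : ∃ l : ℤ, l ≠ 0 ∧ (l = F.coeff n ∨ l = G.coeff n) := by
    rcases hlead with h | h
    exacts [⟨_, h, Or.inl rfl⟩, ⟨_, h, Or.inr rfl⟩]
  refine ⟨c * l ^ (N + n), mul_ne_zero hc (pow_ne_zero _ hl), fun r k hk => ?_⟩
  set g := homogEval n G r.num (r.den : ℤ) with hg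
  have hgF : g ∣ homogEval n F r.num (r.den : ℤ) := by
    refine ⟨k, ?_⟩
    have h1 := homogEval_num_den n F hF r
    have h2 := homogEval_num_den n G hG r
    have : ((homogEval n F r.num (r.den : ℤ) : ℤ) : ℚ) = (homogEval n G r.num (r.den : ℤ) : ℤ) * k := by
      rw [h1, h2, hk]; ring
    exact_mod_cast this
  have hb : g ∣ c * (r.den : ℤ) ^ (N + n) := by
    have h1 := homogEval_num_den n F hF r
    have h2 := homogEval_num_den n G hG r
    have h3 := homogEval_num_den N U (le_max_left _ _) r
    have h4 := homogEval_num_den N V (le_max_right _ _) r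
    have h5 : aeval r U * aeval r F + aeval r V * aeval r G = c := by
      rw [← map_mul, ← map_mul, ← map_add, hUV]; simp
    have h6 : c * (r.den : ℤ) ^ (N + n) =
        homogEval N U r.num (r.den : ℤ) * homogEval n F r.num (r.den : ℤ) +
          homogEval N V r.num (r.den : ℤ) * g := by
      have : (c : ℚ) * (r.den : ℚ) ^ (N + n) =
        (homogEval N U r.num (r.den : ℤ) : ℤ) * (homogEval n F r.num (r.den : ℤ) : ℤ) +
          (homogEval N V r.num (r.den : ℤ) : ℤ) * (homogEval n G r.num (r.den : ℤ) : ℤ) := by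
        rw [h1, h2, h3, h4, ← h5]; ring
      exact_mod_cast this
    rw [h6]
    exact dvd_add (hgF.mul_left _) (dvd_mul_left _ _)
  have hla : ∃ s : ℤ, g ∣ l * r.num ^ n - r.den * s := by
    rcases hlFG with rfl | rfl
    · obtain ⟨s, hs⟩ := dvd_homogEval_sub n F r.num r.den
      exact ⟨-s, by rw [show F.coeff n * r.num ^ n - r.den * -s = homogEval n F r.num (r.den : ℤ) by
        linear_combination -hs]; exact hgF⟩
    · obtain ⟨s, hs⟩ := dvd_homogEval_sub n G r.num r.den
      exact ⟨-s, by rw [show G.coeff n * r.num ^ n - r.den * -s = g by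
        linear_combination -hs]⟩
  obtain ⟨s, hs⟩ := hla
  have ha : g ∣ c * (l * r.num ^ n) ^ (N + n) := by
    have h1 : g ∣ (l * r.num ^ n) ^ (N + n) - (r.den * s) ^ (N + n) := hs.trans (sub_dvd_pow_sub_pow _ _ _)
    have h2 : c * (l * r.num ^ n) ^ (N + n) = c * ((l * r.num ^ n) ^ (N + n) - (r.den * s) ^ (N + n)) +
        (c * (r.den : ℤ) ^ (N + n)) * s ^ (N + n) := by rw [mul_pow (r.den : ℤ)]; ring
    rw [h2]
    exact dvd_add (h1.mul_left _) (hb.mul_right _)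
  have hcop : IsCoprime ((r.num ^ n) ^ (N + n)) ((r.den : ℤ) ^ (N + n)) :=
    ((Int.isCoprime_iff_gcd_eq_one.mpr (by simpa [Int.gcd] using r.reduced)).pow_left).pow
  obtain ⟨x, y, hxy⟩ := hcop
  have : c * l ^ (N + n) = x * (c * (l * r.num ^ n) ^ (N + n)) + y * l ^ (N + n) * (c * (r.den : ℤ) ^ (N + n)) := by
    rw [mul_pow l]
    linear_combination (-(c * l ^ (N + n))) * hxy
  rw [this]
  exact dvd_add (ha.mul_left _) (hb.mul_left _)

lemma exists_int_poly (p : ℚ[X]) : ∃ (P : ℤ[X]) (m : ℤ), m ≠ 0 ∧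
    P.map (Int.castRingHom ℚ) = C (m : ℚ) * p := by
  obtain ⟨b, hb, hbp⟩ := IsLocalization.integerNormalization_spec (nonZeroDivisors ℤ) p
  refine ⟨_, b, nonZeroDivisors.ne_zero hb, hbp.trans ?_⟩
  rw [← smul_eq_C_mul, Int.cast_smul_eq_zsmul]

/-- The radical of an integral polynomial, with cleared denominators. -/
lemma exists_separable_factor (G : ℤ[X]) (hG : G ≠ 0) : ∃ (h h' : ℤ[X]) (m : ℤ) (R : Finset ℂ),
    m ≠ 0 ∧ h * h' = C m * G ∧ (∀ β ∈ R, aeval β h = 0) ∧ R.card = h.natDegree ∧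
    ∀ β : ℂ, aeval β G = 0 → β ∈ R := by
  set Q := G.map (Int.castRingHom ℚ) with hQ
  have hinj : Function.Injective (Int.castRingHom ℚ) := RingHom.injective_int _
  have hQ0 : Q ≠ 0 := (Polynomial.map_ne_zero_iff hinj).mpr hG
  set q := UniqueFactorizationMonoid.radical Q with hq
  obtain ⟨q', hq'⟩ : q ∣ Q := UniqueFactorizationMonoid.radical_dvd_self
  obtain ⟨e, he⟩ := UniqueFactorizationMonoid.exists_dvd_radical_self_pow hQ0
  have hq0 : q ≠ 0 := UniqueFactorizationMonoid.radical_ne_zero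
  have hsep : q.Separable := PerfectField.separable_iff_squarefree.mpr
    UniqueFactorizationMonoid.squarefree_radical
  obtain ⟨h, m, hm, hh⟩ := exists_int_poly q
  obtain ⟨h', m', hm', hh'⟩ := exists_int_poly q'
  have hmq : (m : ℚ) ≠ 0 := Int.cast_ne_zero.mpr hm
  have haev : ∀ β : ℂ, aeval β h = m * aeval β q := by
    intro β
    have h1 : aeval β h = aeval β (h.map (Int.castRingHom ℚ)) := (aeval_map_algebraMap ℚ β h).symm
    rw [h1, hh]
    simp
  refine ⟨h, h', m * m', (q.rootSet ℂ).toFinset, mul_ne_zero hm hm', ?_, ?_, ?_, ?_⟩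
  · apply Polynomial.map_injective _ hinj
    rw [Polynomial.map_mul, hh, hh', Polynomial.map_mul, ← hQ, hq', Polynomial.map_C]
    simp only [eq_intCast, Int.cast_mul, C_mul]
    ring
  · intro β hβ
    rw [Set.mem_toFinset, mem_rootSet] at hβ
    rw [haev, hβ.2, mul_zero]
  · rw [Set.toFinset_card, card_rootSet_eq_natDegree hsep (IsAlgClosed.splits _),
      ← natDegree_map_eq_of_injective hinj h, hh, natDegree_C_mul hmq]
  · intro β hβ
    rw [Set.mem_toFinset, mem_rootSet]
    refine ⟨hq0, ?_⟩
    obtain ⟨t, ht⟩ := he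
    have h1 : aeval β Q = 0 := by rw [hQ]; exact (aeval_map_algebraMap ℚ β G).trans hβ
    have h2 : aeval β q ^ e = 0 := by rw [← map_pow, ht, map_mul, h1, zero_mul]
    exact eq_zero_of_pow_eq_zero h2

lemma finite_setOf_aeval_eq (G : ℤ[X]) (hG : 0 < G.natDegree) (c : ℚ) :
    {r : ℚ | aeval r G = c}.Finite := by
  set Q : ℚ[X] := G.map (Int.castRingHom ℚ) - C c with hQ
  have hdeg : 0 < Q.natDegree := by
    rw [hQ, natDegree_sub_C, natDegree_map_eq_of_injective (RingHom.injective_int _)]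
    exact hG
  have hQ0 : Q ≠ 0 := by
    intro h
    rw [h] at hdeg
    simp at hdeg
  refine (Q.roots.toFinset.finite_toSet).subset fun r hr => ?_
  rw [Set.mem_ofPred_eq] at hr
  rw [Finset.mem_coe, Multiset.mem_toFinset, mem_roots hQ0, IsRoot, hQ, eval_sub, eval_C, ← hr,
    eval_map]
  exact sub_self _

/-- The version of `finite_integral_values` with integral coefficients and an explicit Bézout
identity. -/
theorem finite_integral_values_int (F G U V : ℤ[X]) (c : ℤ) (hc : c ≠ 0) (hUV : U * F + V * G = C c)
    (n : ℕ) (hF : F.natDegree ≤ n) (hG : G.natDegree ≤ n) (hlead : F.coeff n ≠ 0 ∨ G.coeff n ≠ 0)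
    (hpole : G.coeff n = 0 ∧ 0 < G.natDegree ∨
      ∃ S : Finset ℂ, 3 ≤ S.card ∧ ∀ β ∈ S, aeval β G = 0) :
    {r : ℚ | aeval r G ≠ 0 ∧ ∃ k : ℤ, aeval r F = k * aeval r G}.Finite := by
  obtain ⟨M, hM, hdvd⟩ := exists_homogEval_dvd F G U V c hc hUV n hF hG hlead
  rcases hpole with ⟨hcoeff, hdeg⟩ | ⟨S, hS, hSG⟩
  · have hfin : (⋃ g ∈ Set.Icc (-|M|) |M|, ⋃ b ∈ Set.Icc (-|M|) |M|,
        {r : ℚ | aeval r G = (g : ℚ) / (b : ℚ) ^ n}).Finite :=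
      (Set.finite_Icc _ _).biUnion fun g _ => (Set.finite_Icc _ _).biUnion fun b _ =>
        finite_setOf_aeval_eq G hdeg _
    refine hfin.subset ?_
    rintro r ⟨-, k, hk⟩
    have h1 := hdvd r k hk
    have h2 : (r.den : ℤ) ∣ M := by
      refine dvd_trans ?_ h1
      have := dvd_homogEval_sub n G r.num r.den
      rwa [hcoeff, zero_mul, sub_zero] at this
    have hle : ∀ x : ℤ, x ∣ M → x ∈ Set.Icc (-|M|) |M| := fun x hx =>
      abs_le.mp (Int.le_of_dvd (abs_pos.mpr hM) ((abs_dvd_abs x M).mpr hx))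
    refine Set.mem_biUnion (hle _ h1) (Set.mem_biUnion (hle _ h2) ?_)
    have hb : (r.den : ℚ) ≠ 0 := by exact_mod_cast r.den_ne_zero
    rw [Set.mem_ofPred_eq, homogEval_num_den n G hG r, Int.cast_natCast]
    field_simp
  · rcases eq_or_ne G 0 with rfl | hG0
    · simp
    obtain ⟨h, h', m, R, hm, hhG, hR, hcard, hroots⟩ := exists_separable_factor G hG0
    have hD : 3 ≤ h.natDegree := by
      rw [← hcard]
      exact hS.trans (Finset.card_le_card fun β hβ => hroots β (hSG β hβ))
    have hprod0 : h * h' ≠ 0 := by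
      rw [hhG]
      exact mul_ne_zero (C_ne_zero.mpr hm) hG0
    have hdeg : h.natDegree + h'.natDegree ≤ n := by
      rw [← natDegree_mul (left_ne_zero_of_mul hprod0) (right_ne_zero_of_mul hprod0), hhG,
        natDegree_C_mul hm]
      exact hG
    refine (finite_small_values h R hR hcard hD |(m * M : ℤ)|).subset ?_
    rintro r ⟨-, k, hk⟩
    rw [Set.mem_ofPred_eq]
    have h1 := homogEval_num_den h.natDegree h le_rfl r
    have h2 := homogEval_num_den h'.natDegree h' le_rfl r
    have h3 := homogEval_num_den n G hG r
    have h4 : homogEval h.natDegree h r.num (r.den : ℤ) ∣ m * M := by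
      refine dvd_trans ⟨homogEval h'.natDegree h' r.num (r.den : ℤ) *
        (r.den : ℤ) ^ (n - (h.natDegree + h'.natDegree)), ?_⟩ (mul_dvd_mul_left m (hdvd r k hk))
      have h5 : aeval r h * aeval r h' = m * aeval r G := by
        rw [← map_mul, hhG]
        simp
      have h6 : (r.den : ℚ) ^ n = (r.den : ℚ) ^ h.natDegree * (r.den : ℚ) ^ h'.natDegree *
          (r.den : ℚ) ^ (n - (h.natDegree + h'.natDegree)) := by
        rw [← pow_add, ← pow_add]
        congr 1
        omega
      have : ((m : ℤ) : ℚ) * (homogEval n G r.num (r.den : ℤ) : ℤ) =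
          (homogEval h.natDegree h r.num (r.den : ℤ) : ℤ) *
          ((homogEval h'.natDegree h' r.num (r.den : ℤ) : ℤ) *
          (r.den : ℚ) ^ (n - (h.natDegree + h'.natDegree))) := by
        rw [h1, h2, h3, h6]
        linear_combination (-((r.den : ℚ) ^ h.natDegree * (r.den : ℚ) ^ h'.natDegree *
          (r.den : ℚ) ^ (n - (h.natDegree + h'.natDegree)))) * h5
      exact_mod_cast this
    have h7 := Int.le_of_dvd (abs_pos.mpr (mul_ne_zero hm hM)) ((abs_dvd_abs _ _).mpr h4)
    have h8 : ‖aeval (r : ℂ) h‖ * r.den ^ h.natDegree =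
        |((homogEval h.natDegree h r.num (r.den : ℤ) : ℤ) : ℝ)| := by
      have h9 : aeval (r : ℂ) h = ((aeval r h : ℚ) : ℂ) := by
        have := aeval_algebraMap_apply ℂ r h
        simpa using this
      have h10 : ((homogEval h.natDegree h r.num (r.den : ℤ) : ℤ) : ℝ) =
          (r.den : ℝ) ^ h.natDegree * ((aeval r h : ℚ) : ℝ) := by exact_mod_cast h1
      rw [h9, h10, abs_mul, abs_of_nonneg (by positivity : (0 : ℝ) ≤ (r.den : ℝ) ^ h.natDegree),
        mul_comm]
      congr 1
      rw [← Complex.ofReal_ratCast, Complex.norm_real, Real.norm_eq_abs]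
    rw [h8]
    exact_mod_cast h7

/-- A rational function with at least three poles on the projective line takes integral values
at only finitely many rational points. -/
theorem finite_integral_values (F G : ℚ[X]) (hFG : IsCoprime F G)
    (n : ℕ) (hF : F.natDegree ≤ n) (hG : G.natDegree ≤ n) (hlead : F.coeff n ≠ 0 ∨ G.coeff n ≠ 0)
    (hpole : G.coeff n = 0 ∧ 0 < G.natDegree ∨
      ∃ S : Finset ℂ, 3 ≤ S.card ∧ ∀ β ∈ S, aeval β G = 0) :
    {r : ℚ | G.eval r ≠ 0 ∧ ∃ k : ℤ, F.eval r = k * G.eval r}.Finite := by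
  have hinj : Function.Injective (Int.castRingHom ℚ) := RingHom.injective_int _
  obtain ⟨F₁, m₁, hm₁, hF₁⟩ := exists_int_poly F
  obtain ⟨G₁, m₂, hm₂, hG₁⟩ := exists_int_poly G
  obtain ⟨U, V, hUV⟩ := hFG
  obtain ⟨U₁, m₃, hm₃, hU₁⟩ := exists_int_poly U
  obtain ⟨V₁, m₄, hm₄, hV₁⟩ := exists_int_poly V
  have hq₁ : (m₁ : ℚ) ≠ 0 := Int.cast_ne_zero.mpr hm₁
  have hq₂ : (m₂ : ℚ) ≠ 0 := Int.cast_ne_zero.mpr hm₂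
  have haevF : ∀ r : ℚ, aeval r F₁ = m₁ * F.eval r := fun r => by
    rw [← aeval_map_algebraMap ℚ r F₁, algebraMap_int_eq, hF₁]
    simp
  have haevG : ∀ r : ℚ, aeval r G₁ = m₂ * G.eval r := fun r => by
    rw [← aeval_map_algebraMap ℚ r G₁, algebraMap_int_eq, hG₁]
    simp
  have hcoF : ((F₁.coeff n : ℤ) : ℚ) = m₁ * F.coeff n := by
    rw [← coeff_C_mul, ← hF₁, coeff_map]; rfl
  have hcoG : ((G₁.coeff n : ℤ) : ℚ) = m₂ * G.coeff n := by
    rw [← coeff_C_mul, ← hG₁, coeff_map]; rfl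
  have hdF : F₁.natDegree = F.natDegree := by
    rw [← natDegree_map_eq_of_injective hinj, hF₁, natDegree_C_mul hq₁]
  have hdG : G₁.natDegree = G.natDegree := by
    rw [← natDegree_map_eq_of_injective hinj, hG₁, natDegree_C_mul hq₂]
  refine (finite_integral_values_int (C m₂ * F₁) (C m₁ * G₁) (C m₄ * U₁) (C m₃ * V₁)
    (m₁ * m₂ * m₃ * m₄) (by simp [*]) ?_ n ?_ ?_ ?_ ?_).subset ?_
  · apply Polynomial.map_injective _ hinj
    simp only [Polynomial.map_add, Polynomial.map_mul, hF₁, hG₁, hU₁, hV₁, eq_intCast,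
      Int.cast_mul, Polynomial.map_intCast, map_intCast]
    linear_combination (m₁ * m₂ * m₃ * m₄ : ℚ[X]) * hUV
  · rwa [natDegree_C_mul hm₂, hdF]
  · rwa [natDegree_C_mul hm₁, hdG]
  · simp only [coeff_C_mul]
    refine hlead.imp (fun h => mul_ne_zero hm₂ ?_) fun h => mul_ne_zero hm₁ ?_
    · rw [← Int.cast_ne_zero (α := ℚ), hcoF]
      exact mul_ne_zero hq₁ h
    · rw [← Int.cast_ne_zero (α := ℚ), hcoG]
      exact mul_ne_zero hq₂ h
  · refine hpole.imp (fun h => ⟨?_, ?_⟩) fun ⟨S, hS, h⟩ => ⟨S, hS, fun β hβ => ?_⟩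
    · rw [coeff_C_mul, ← Int.cast_inj (α := ℚ), Int.cast_mul, hcoG, h.1]
      simp
    · rw [natDegree_C_mul hm₁, hdG]
      exact h.2
    · rw [map_mul, ← aeval_map_algebraMap ℚ β G₁, algebraMap_int_eq, hG₁, map_mul, h β hβ]
      simp
  · rintro r ⟨hr, k, hk⟩
    refine ⟨?_, k, ?_⟩
    · rw [map_mul, haevG]
      simp [*]
    · rw [map_mul, map_mul, haevF, haevG, hk]
      simp
      ring

lemma natDegree_homogEval_le {K : Type*} [Field K] (d n : ℕ) (p F G : K[X]) (hF : F.natDegree ≤ n)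
    (hG : G.natDegree ≤ n) : (homogEval d p F G).natDegree ≤ d * n := by
  refine natDegree_sum_le_of_forall_le _ _ fun i hi => ?_
  rw [Finset.mem_range] at hi
  refine natDegree_mul_le.trans ?_
  have h1 : (algebraMap K K[X] (p.coeff i) * F ^ i).natDegree ≤ i * n :=
    (natDegree_C_mul_le _ _).trans (natDegree_pow_le_of_le i hF)
  have h2 : (G ^ (d - i)).natDegree ≤ (d - i) * n := natDegree_pow_le_of_le _ hG
  calc _ ≤ i * n + (d - i) * n := add_le_add h1 h2
    _ = d * n := by rw [← add_mul]; congr 1; omega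

lemma coeff_homogEval {K : Type*} [Field K] (d n : ℕ) (p F G : K[X]) (hF : F.natDegree ≤ n)
    (hG : G.natDegree ≤ n) :
    (homogEval d p F G).coeff (d * n) = homogEval d p (F.coeff n) (G.coeff n) := by
  rw [homogEval, homogEval, finsetSum_coeff]
  refine Finset.sum_congr rfl fun i hi => ?_
  rw [Finset.mem_range] at hi
  have h1 : d * n = i * n + (d - i) * n := by rw [← add_mul]; congr 1; omega
  rw [mul_assoc, mul_assoc, h1, ← C_eq_algebraMap, coeff_C_mul,
    coeff_mul_add_eq_of_natDegree_le (natDegree_pow_le_of_le i hF) (natDegree_pow_le_of_le _ hG),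
    coeff_pow_of_natDegree_le hF, coeff_pow_of_natDegree_le hG]
  rfl

/-- The self-map of the projective line induced by a pair of polynomials. -/
noncomputable def pairMap {K : Type*} [Field K] (p q : K[X]) : Option K → Option K
  | some x => if q.eval x = 0 then none else some (p.eval x / q.eval x)
  | none =>
      if q.natDegree < p.natDegree then none
      else if p.natDegree < q.natDegree then some 0
      else some (p.leadingCoeff / q.leadingCoeff)

/-- The point of the projective line with homogeneous coordinates `(a, b)`. -/
noncomputable def proj {K : Type*} [Field K] (a b : K) : Option K :=
  if b = 0 then none else some (a / b)

lemma pairMap_proj {K : Type*} [Field K] (p q : K[X]) (hpq : IsCoprime p q) (d : ℕ)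
    (hd : d = max p.natDegree q.natDegree) (hd0 : 0 < d) (a b : K) (hab : a ≠ 0 ∨ b ≠ 0) :
    (homogEval d p a b ≠ 0 ∨ homogEval d q a b ≠ 0) ∧
      pairMap p q (proj a b) = proj (homogEval d p a b) (homogEval d q a b) := by
  have hp : p.natDegree ≤ d := hd ▸ le_max_left _ _
  have hq : q.natDegree ≤ d := hd ▸ le_max_right _ _
  by_cases hb : b = 0
  · subst hb
    have ha : a ≠ 0 := by simpa using hab
    have had : a ^ d ≠ 0 := pow_ne_zero _ ha
    simp only [homogEval_zero_right, Algebra.algebraMap_self, RingHom.id_apply, proj, if_true, pairMap,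
      mul_eq_zero, had, or_false, ne_eq]
    rcases lt_trichotomy q.natDegree p.natDegree with h | h | h
    · have hdp : d = p.natDegree := by omega
      have h1 : q.coeff d = 0 := coeff_eq_zero_of_natDegree_lt (by omega)
      have h2 : p.coeff d ≠ 0 := by
        rw [hdp]
        exact leadingCoeff_ne_zero.mpr (by rintro rfl; simp at h)
      simp [h1, h2, h]
    · have hdp : d = p.natDegree := by omega
      have hdq : d = q.natDegree := by omega
      have h1 : q.coeff d ≠ 0 := by
        rw [hdq]
        exact leadingCoeff_ne_zero.mpr (by rintro rfl; simp at hdq; omega)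
      simp only [h, lt_irrefl, if_false, h1, not_false_iff, or_true, true_and]
      rw [mul_div_mul_right _ _ had, leadingCoeff, leadingCoeff, ← hdp, ← hdq]
    · have hdq : d = q.natDegree := by omega
      have h1 : p.coeff d = 0 := coeff_eq_zero_of_natDegree_lt (by omega)
      have h2 : q.coeff d ≠ 0 := by
        rw [hdq]
        exact leadingCoeff_ne_zero.mpr (by rintro rfl; simp at h)
      simp [h1, h2, h, h.not_gt]
  · have hbd : b ^ d ≠ 0 := pow_ne_zero _ hb
    have h1 := aeval_ne_zero_of_isCoprime hpq (a / b)
    rw [homogEval_of_ne_zero d p hp a b hb, homogEval_of_ne_zero d q hq a b hb]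
    simp only [proj, hb, if_false, pairMap, mul_eq_zero, hbd, false_or, ne_eq, coe_aeval_eq_eval] at h1 ⊢
    refine ⟨h1, ?_⟩
    rw [mul_div_mul_left _ _ hbd]

/-- Homogeneous lifts of the iterates of `p / q`, dehomogenised. -/
noncomputable def iterPair {K : Type*} [Field K] (d : ℕ) (p q : K[X]) : ℕ → K[X] × K[X]
  | 0 => (X, 1)
  | k + 1 => (homogEval d p (iterPair d p q k).1 (iterPair d p q k).2,
      homogEval d q (iterPair d p q k).1 (iterPair d p q k).2)

section iterPair

variable {K : Type*} [Field K] (p q : K[X]) (d : ℕ)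

lemma map_iterPair {L : Type*} [Field L] (φ : K →+* L) (k : ℕ) :
    iterPair d (p.map φ) (q.map φ) k =
      ((iterPair d p q k).1.map φ, (iterPair d p q k).2.map φ) := by
  induction k with
  | zero => simp [iterPair]
  | succ k ih =>
    simp only [iterPair, ih]
    simp [homogEval, Polynomial.map_sum]

lemma natDegree_iterPair_le (k : ℕ) :
    (iterPair d p q k).1.natDegree ≤ d ^ k ∧ (iterPair d p q k).2.natDegree ≤ d ^ k := by
  induction k with
  | zero => simp [iterPair]
  | succ k ih =>
    rw [pow_succ']
    exact ⟨natDegree_homogEval_le _ _ _ _ _ ih.1 ih.2, natDegree_homogEval_le _ _ _ _ _ ih.1 ih.2⟩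

lemma iterate_pairMap_some (hpq : IsCoprime p q) (hd : d = max p.natDegree q.natDegree)
    (hd0 : 0 < d) (k : ℕ) (x : K) :
    ((iterPair d p q k).1.eval x ≠ 0 ∨ (iterPair d p q k).2.eval x ≠ 0) ∧
      (pairMap p q)^[k] (some x) = proj ((iterPair d p q k).1.eval x) ((iterPair d p q k).2.eval x) := by
  induction k with
  | zero => simp [iterPair, proj]
  | succ k ih =>
    have h1 := pairMap_proj p q hpq d hd hd0 _ _ ih.1
    have h2 := map_homogEval (aeval x) d p (iterPair d p q k).1 (iterPair d p q k).2
    have h3 := map_homogEval (aeval x) d q (iterPair d p q k).1 (iterPair d p q k).2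
    simp only [coe_aeval_eq_eval] at h2 h3
    rw [Function.iterate_succ_apply', ih.2]
    simp only [iterPair]
    rw [h2, h3]
    exact h1

lemma iterate_pairMap_none (hpq : IsCoprime p q) (hd : d = max p.natDegree q.natDegree)
    (hd0 : 0 < d) (k : ℕ) :
    ((iterPair d p q k).1.coeff (d ^ k) ≠ 0 ∨ (iterPair d p q k).2.coeff (d ^ k) ≠ 0) ∧
      (pairMap p q)^[k] none =
        proj ((iterPair d p q k).1.coeff (d ^ k)) ((iterPair d p q k).2.coeff (d ^ k)) := by
  induction k with
  | zero => simp [iterPair, proj, coeff_one]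
  | succ k ih =>
    have h0 := natDegree_iterPair_le p q d k
    rw [Function.iterate_succ_apply', ih.2]
    simp only [iterPair]
    rw [pow_succ', coeff_homogEval _ _ _ _ _ h0.1 h0.2, coeff_homogEval _ _ _ _ _ h0.1 h0.2]
    exact pairMap_proj p q hpq d hd hd0 _ _ ih.1

lemma isCoprime_iterPair (hpq : IsCoprime p q) (hd : d = max p.natDegree q.natDegree)
    (hd0 : 0 < d) (k : ℕ) : IsCoprime (iterPair d p q k).1 (iterPair d p q k).2 := by
  rw [← isCoprime_map (algebraMap K (AlgebraicClosure K)),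
    isCoprime_iff_aeval_ne_zero_of_isAlgClosed (AlgebraicClosure K) (k := AlgebraicClosure K)]
  intro a
  have := (iterate_pairMap_some (p.map (algebraMap K (AlgebraicClosure K)))
    (q.map (algebraMap K (AlgebraicClosure K))) d ((isCoprime_map _).mpr hpq)
    (by simpa using hd) hd0 k a).1
  rw [map_iterPair] at this
  simpa using this

lemma iterPair_snd_ne_zero (hpq : IsCoprime p q) (hd : d = max p.natDegree q.natDegree)
    (hd0 : 0 < d) (k : ℕ) : (iterPair d p q k).2 ≠ 0 := by
  intro h
  have h1 := isCoprime_iterPair p q d hpq hd hd0 k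
  have h2 := (iterate_pairMap_none p q d hpq hd hd0 k).1
  rw [h, isCoprime_zero_right] at h1
  rw [h, coeff_zero, coeff_eq_zero_of_natDegree_lt
    ((natDegree_eq_zero_of_isUnit h1).trans_lt (pow_pos hd0 k))] at h2
  simp at h2

end iterPair

/-- A surjective self-map with at most two values having a single preimage has three points in
the fourth backward orbit of `o`, unless `o` is totally invariant under the second iterate. -/
lemma exists_three_preimages {α : Type*} (φ : α → α) (hs : Function.Surjective φ) (o : α)
    (hT : ∀ a b c, a ≠ b → a ≠ c → b ≠ c → (∀ x y, φ x = a → φ y = a → x = y) →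
      (∀ x y, φ x = b → φ y = b → x = y) → (∀ x y, φ x = c → φ y = c → x = y) → False)
    (hne : ¬ ∀ x, φ (φ x) = o ↔ x = o) :
    ∃ x y z, x ≠ y ∧ x ≠ z ∧ y ≠ z ∧ φ^[4] x = o ∧ φ^[4] y = o ∧ φ^[4] z = o := by
  by_contra hno
  have hno' : ∀ k ≤ 4, ∀ x y z, x ≠ y → x ≠ z → y ≠ z → φ^[k] x = o → φ^[k] y = o → φ^[k] z = o →
      False := by
    intro k hk x y z hxy hxz hyz hx hy hz
    have hsk := hs.iterate (4 - k)
    obtain ⟨x', rfl⟩ := hsk x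
    obtain ⟨y', rfl⟩ := hsk y
    obtain ⟨z', rfl⟩ := hsk z
    rw [← Function.iterate_add_apply, show k + (4 - k) = 4 by omega] at hx hy hz
    exact hno ⟨x', y', z', fun h => hxy (by rw [h]), fun h => hxz (by rw [h]),
      fun h => hyz (by rw [h]), hx, hy, hz⟩
  have hsub : ∀ k ≤ 3, ∀ u v, u ≠ v → φ^[k] u = o → φ^[k] v = o →
      ∀ x y, φ x = u → φ y = u → x = y := by
    intro k hk u v huv hu hv x y hx hy
    by_contra hxy
    obtain ⟨z, hz⟩ := hs v
    refine hno' (k + 1) (by omega) x y z hxy ?_ ?_ ?_ ?_ ?_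
    · rintro rfl
      exact huv (hx.symm.trans hz)
    · rintro rfl
      exact huv (hy.symm.trans hz)
    all_goals rw [Function.iterate_succ_apply]
    · rw [hx, hu]
    · rw [hy, hu]
    · rw [hz, hv]
  have huniq : ∀ k ≤ 2, ∀ u v, φ^[k] u = o → φ^[k] v = o → u = v := by
    intro k hk u v hu hv
    by_contra huv
    obtain ⟨u', hu'⟩ := hs u
    obtain ⟨v', hv'⟩ := hs v
    have huv' : u' ≠ v' := by
      rintro rfl
      exact huv (hu'.symm.trans hv')
    have h1 : φ^[k + 1] u' = o := by rw [Function.iterate_succ_apply, hu', hu]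
    have h2 : φ^[k + 1] v' = o := by rw [Function.iterate_succ_apply, hv', hv]
    have hTu := hsub k (by omega) u v huv hu hv
    have hTv := hsub k (by omega) v u (Ne.symm huv) hv hu
    have hTu' := hsub (k + 1) (by omega) u' v' huv' h1 h2
    have hTv' := hsub (k + 1) (by omega) v' u' huv'.symm h2 h1
    have h3 : u = u' ∨ v = u' := by
      by_contra! h
      exact hT u v u' huv h.1 h.2 hTu hTv hTu'
    have h4 : u = v' ∨ v = v' := by
      by_contra! h
      exact hT u v v' huv h.1 h.2 hTu hTv hTv'
    have h5 : (φ u = u ∧ φ v = v) ∨ (φ u = v ∧ φ v = u) := by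
      rcases h3 with rfl | rfl <;> rcases h4 with rfl | rfl
      · exact absurd rfl huv'
      · exact Or.inl ⟨hu', hv'⟩
      · exact Or.inr ⟨hv', hu'⟩
      · exact absurd rfl huv'
    have h6 : φ^[k] u = φ^[k] v := hu.trans hv.symm
    interval_cases k <;> rcases h5 with ⟨h5, h7⟩ | ⟨h5, h7⟩ <;>
      simp [h5, h7] at h6 <;> first | exact huv h6 | exact huv h6.symm
  obtain ⟨p, hp⟩ := hs o
  obtain ⟨q, hq⟩ := hs p
  have hq2 : ∀ x, φ (φ x) = o ↔ x = q := fun x =>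
    ⟨fun h => huniq 2 le_rfl x q h (by simp [hq, hp]), fun h => by rw [h, hq, hp]⟩
  have hqo : q ≠ o := by
    rintro rfl
    exact hne hq2
  have hpo : p ≠ o := by
    rintro rfl
    exact hqo ((hq2 p).mp (by rw [hp, hp])).symm
  have hTo : ∀ x y, φ x = o → φ y = o → x = y := fun x y => huniq 1 (by omega) x y
  have hTp : ∀ x y, φ x = p → φ y = p → x = y := fun x y hx hy =>
    huniq 2 le_rfl x y (by simp [hx, hp]) (by simp [hy, hp])
  have hqp : q ≠ p := by
    rintro rfl
    exact hqo (hq.symm.trans hp)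
  refine hT o p q hpo.symm hqo.symm hqp.symm hTo hTp fun r s hr hs' => ?_
  by_contra hrs
  have hr3 : φ^[3] r = o := by simp [hr, hq, hp]
  have hs3 : φ^[3] s = o := by simp [hs', hq, hp]
  have hTr := hsub 3 le_rfl r s hrs hr3 hs3
  have hTs := hsub 3 le_rfl s r (Ne.symm hrs) hs3 hr3
  have key : ∀ w, φ w = q → (∀ x y, φ x = w → φ y = w → x = y) → w = o := by
    intro w hw hTw
    by_contra hwo
    refine hT o p w hpo.symm (Ne.symm hwo) ?_ hTo hTp hTw
    rintro rfl
    exact hqo (hw.symm.trans hp)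
  exact hrs ((key r hr hTr).trans (key s hs' hTs).symm)

/-- Homogeneous coordinates `(1, v)` or `(0, -1)` of the equation of a point. -/
def coords {K : Type*} [Field K] : Option K → K × K
  | none => (0, -1)
  | some v => (1, v)

lemma coords_det_ne_zero {K : Type*} [Field K] (s t : Option K) (h : s ≠ t) :
    (coords s).1 * (coords t).2 - (coords t).1 * (coords s).2 ≠ 0 := by
  rcases s with _ | s <;> rcases t with _ | t <;> simp [coords] at h ⊢
  rw [sub_eq_zero]
  exact fun h' => h h'.symm

lemma proj_eq_iff {K : Type*} [Field K] (a b : K) (hab : a ≠ 0 ∨ b ≠ 0) (t : Option K) :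
    proj a b = t ↔ (coords t).1 * a - (coords t).2 * b = 0 := by
  rcases t with _ | v <;> by_cases hb : b = 0 <;> simp [proj, coords, hb] at hab ⊢
  · exact hab
  · rw [sub_eq_zero, div_eq_iff hb]

/-- A polynomial whose roots are the finite points of the fibre of `p / q` over `t`. -/
noncomputable def fiberPoly {K : Type*} [Field K] (p q : K[X]) (t : Option K) : K[X] :=
  C (coords t).1 * p - C (coords t).2 * q

section fiberPoly

variable {K : Type*} [Field K] (p q : K[X]) (d : ℕ)

lemma pairMap_some_eq_iff (hpq : IsCoprime p q) (t : Option K) (z : K) :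
    pairMap p q (some z) = t ↔ (fiberPoly p q t).eval z = 0 := by
  have h1 := aeval_ne_zero_of_isCoprime hpq z
  rw [coe_aeval_eq_eval] at h1
  rw [show pairMap p q (some z) = proj (p.eval z) (q.eval z) from rfl, proj_eq_iff _ _ h1]
  simp [fiberPoly]

lemma pairMap_none_eq_iff (hpq : IsCoprime p q) (hd : d = max p.natDegree q.natDegree)
    (hd0 : 0 < d) (t : Option K) :
    pairMap p q none = t ↔ (fiberPoly p q t).coeff d = 0 := by
  have h1 := pairMap_proj p q hpq d hd hd0 1 0 (Or.inl one_ne_zero)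
  simp only [homogEval_zero_right, one_pow, mul_one, Algebra.algebraMap_self, RingHom.id_apply] at h1
  rw [show proj (1 : K) 0 = none by simp [proj]] at h1
  rw [h1.2, proj_eq_iff _ _ h1.1]
  simp [fiberPoly]

lemma natDegree_fiberPoly_le (hd : d = max p.natDegree q.natDegree) (t : Option K) :
    (fiberPoly p q t).natDegree ≤ d := by
  refine (natDegree_sub_le _ _).trans (hd ▸ max_le_max ?_ ?_) <;> exact natDegree_C_mul_le _ _

lemma fiberPoly_ne_zero (hpq : IsCoprime p q) (hd : d = max p.natDegree q.natDegree)
    (hd0 : 0 < d) (t : Option K) : fiberPoly p q t ≠ 0 := by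
  intro h
  rcases t with _ | v
  · simp [fiberPoly, coords] at h
    subst h
    have := natDegree_eq_zero_of_isUnit (isCoprime_zero_right.mp hpq)
    simp at hd
    omega
  · simp only [fiberPoly, coords, C_1, one_mul, sub_eq_zero] at h
    have hq : IsUnit q := hpq.isUnit_of_dvd' (h ▸ dvd_mul_left _ _) dvd_rfl
    have h1 := natDegree_eq_zero_of_isUnit hq
    have h2 : p.natDegree ≤ q.natDegree := h ▸ natDegree_C_mul_le _ _
    omega

lemma surjective_pairMap [IsAlgClosed K] (hpq : IsCoprime p q) (hd : d = max p.natDegree q.natDegree)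
    (hd0 : 0 < d) : Function.Surjective (pairMap p q) := by
  intro t
  by_cases h : (fiberPoly p q t).coeff d = 0
  · exact ⟨none, (pairMap_none_eq_iff p q d hpq hd hd0 t).mpr h⟩
  · have hdeg : d ≤ (fiberPoly p q t).natDegree := le_natDegree_of_ne_zero h
    obtain ⟨z, hz⟩ := IsAlgClosed.exists_root (fiberPoly p q t)
      fun h' => by have := natDegree_eq_of_degree_eq_some (n := 0) h'; omega
    exact ⟨some z, (pairMap_some_eq_iff p q hpq t z).mpr hz⟩

/-- A point with a single preimage has a power of a linear form as fibre polynomial. -/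
lemma fiberPoly_of_subsingleton [IsAlgClosed K] (hpq : IsCoprime p q)
    (hd : d = max p.natDegree q.natDegree) (hd0 : 0 < d) (t : Option K)
    (ht : ∀ x y, pairMap p q x = t → pairMap p q y = t → x = y) :
    (pairMap p q none = t ∧ ∃ c, c ≠ 0 ∧ fiberPoly p q t = C c) ∨
      ∃ z c, c ≠ 0 ∧ pairMap p q (some z) = t ∧ fiberPoly p q t = C c * (X - C z) ^ d := by
  have h0 := fiberPoly_ne_zero p q d hpq hd hd0 t
  have hfac := (IsAlgClosed.splits (fiberPoly p q t)).eq_prod_roots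
  have hcard := (IsAlgClosed.splits (fiberPoly p q t)).natDegree_eq_card_roots
  have hlc := leadingCoeff_ne_zero.mpr h0
  obtain ⟨x, hx⟩ := surjective_pairMap p q d hpq hd hd0 t
  rcases x with _ | z
  · refine Or.inl ⟨hx, _, hlc, ?_⟩
    have : (fiberPoly p q t).roots = 0 := by
      rw [Multiset.eq_zero_iff_forall_notMem]
      intro z hz
      rw [mem_roots h0] at hz
      have := ht _ _ hx ((pairMap_some_eq_iff p q hpq t z).mpr hz)
      simp at this
    rw [this] at hfac
    simpa using hfac
  · refine Or.inr ⟨z, _, hlc, hx, ?_⟩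
    have hc : (fiberPoly p q t).coeff d ≠ 0 := by
      intro h
      have := ht _ _ hx ((pairMap_none_eq_iff p q d hpq hd hd0 t).mpr h)
      simp at this
    have hdeg : (fiberPoly p q t).natDegree = d :=
      le_antisymm (natDegree_fiberPoly_le p q d hd t) (le_natDegree_of_ne_zero hc)
    have : (fiberPoly p q t).roots = Multiset.replicate d z := by
      rw [Multiset.eq_replicate]
      refine ⟨by rw [← hcard, hdeg], fun w hw => ?_⟩
      rw [mem_roots h0] at hw
      exact Option.some_injective _ (ht _ _ ((pairMap_some_eq_iff p q hpq t w).mpr hw) hx)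
    rw [this] at hfac
    simpa using hfac

end fiberPoly

/-- No two distinct powers of linear forms and a third power of a linear form, or constant, are
linearly dependent. -/
lemma not_powers_dependent (d : ℕ) (hd : 2 ≤ d) (P : ℂ[X]) (a b y z : ℂ) (hyz : y ≠ z)
    (ha : a ≠ 0) (c x : ℂ) (hP : P = C c ∨ (P = C c * (X - C x) ^ d ∧ x ≠ y))
    (hrel : P + C a * (X - C y) ^ d + C b * (X - C z) ^ d = 0) : False := by
  have hd0 : d ≠ 0 := by omega
  have hd1 : d - 1 ≠ 0 := by omega
  have hdC : (d : ℂ) ≠ 0 := Nat.cast_ne_zero.mpr hd0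
  have hy : z - y ≠ 0 := sub_ne_zero.mpr hyz.symm
  have h1 := congrArg (eval z) hrel
  have h2 := congrArg (fun f => eval z (derivative f)) hrel
  rcases hP with rfl | ⟨rfl, hxy⟩
  · simp [derivative_X_sub_C_pow, hd1, hd0, ha, hy] at h2
  · simp only [derivative_X_sub_C_pow, derivative_add, derivative_C_mul, derivative_zero, eval_add, eval_mul,
      eval_pow, eval_sub, eval_X, eval_C, eval_zero, sub_self, zero_pow hd0, zero_pow hd1,
      mul_zero, add_zero] at h1 h2
    have h3 : (d : ℂ) * (a * (z - y) ^ (d - 1) * (x - y)) = 0 := by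
      have hpow : ∀ w : ℂ, w ^ d = w ^ (d - 1) * w := fun w => by
        rw [← pow_succ, Nat.sub_add_cancel (by omega)]
      rw [hpow, hpow] at h1
      linear_combination (d : ℂ) * h1 - (z - x) * h2
    exact mul_ne_zero hdC (mul_ne_zero (mul_ne_zero ha (pow_ne_zero _ hy)) (sub_ne_zero.mpr hxy)) h3

lemma no_three_totally_ramified (p q : ℂ[X]) (d : ℕ) (hpq : IsCoprime p q)
    (hd : d = max p.natDegree q.natDegree) (hd2 : 2 ≤ d) (s t u : Option ℂ) (hst : s ≠ t)
    (hsu : s ≠ u) (htu : t ≠ u) (hs : ∀ x y, pairMap p q x = s → pairMap p q y = s → x = y)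
    (ht : ∀ x y, pairMap p q x = t → pairMap p q y = t → x = y)
    (hu : ∀ x y, pairMap p q x = u → pairMap p q y = u → x = y) : False := by
  have hd0 : 0 < d := by omega
  have core : ∀ s t u : Option ℂ, s ≠ t → s ≠ u → t ≠ u →
      (∃ x c, c ≠ 0 ∧ (fiberPoly p q s = C c ∨
        fiberPoly p q s = C c * (X - C x) ^ d ∧ pairMap p q (some x) = s)) →
      (∃ y c, c ≠ 0 ∧ pairMap p q (some y) = t ∧ fiberPoly p q t = C c * (X - C y) ^ d) →
      (∃ z c, c ≠ 0 ∧ pairMap p q (some z) = u ∧ fiberPoly p q u = C c * (X - C z) ^ d) →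
      False := by
    rintro s t u hst hsu htu ⟨x, c, hc, hs⟩ ⟨y, a, ha, hy, ht⟩ ⟨z, b, hb, hz, hu⟩
    have ht' := coords_det_ne_zero u s hsu.symm
    set e₁ := (coords t).1 * (coords u).2 - (coords u).1 * (coords t).2
    set e₂ := (coords u).1 * (coords s).2 - (coords s).1 * (coords u).2
    set e₃ := (coords s).1 * (coords t).2 - (coords t).1 * (coords s).2
    refine not_powers_dependent d hd2 (C e₁ * fiberPoly p q s) (e₂ * a) (e₃ * b) y z ?_
      (mul_ne_zero ht' ha) (e₁ * c) x ?_ ?_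
    · rintro rfl
      exact htu (hy.symm.trans hz)
    · refine hs.imp (fun h => by rw [h, C_mul]) fun h => ⟨by rw [h.1, C_mul, mul_assoc], ?_⟩
      rintro rfl
      exact hst (h.2.symm.trans hy)
    · rw [C_mul, mul_assoc, ← ht, C_mul, mul_assoc, ← hu]
      simp only [fiberPoly, e₁, e₂, e₃, C_sub, C_mul]
      ring
  have fs := fiberPoly_of_subsingleton p q d hpq hd hd0 s hs
  have ft := fiberPoly_of_subsingleton p q d hpq hd hd0 t ht
  have fu := fiberPoly_of_subsingleton p q d hpq hd hd0 u hu
  have weak : ∀ v, ((pairMap p q none = v ∧ ∃ c, c ≠ 0 ∧ fiberPoly p q v = C c) ∨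
      ∃ z c, c ≠ 0 ∧ pairMap p q (some z) = v ∧ fiberPoly p q v = C c * (X - C z) ^ d) →
      ∃ x c, c ≠ 0 ∧ (fiberPoly p q v = C c ∨
        fiberPoly p q v = C c * (X - C x) ^ d ∧ pairMap p q (some x) = v) := by
    rintro v (⟨-, c, hc, h⟩ | ⟨z, c, hc, hz, h⟩)
    · exact ⟨0, c, hc, Or.inl h⟩
    · exact ⟨z, c, hc, Or.inr ⟨h, hz⟩⟩
  rcases ft with ⟨ht', ht''⟩ | ft'
  · refine core t s u hst.symm htu hsu (weak t (Or.inl ⟨ht', ht''⟩)) ?_ ?_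
    · exact fs.resolve_left fun h => hst (h.1.symm.trans ht')
    · exact fu.resolve_left fun h => htu (ht'.symm.trans h.1)
  · rcases fu with ⟨hu', hu''⟩ | fu'
    · refine core u s t hsu.symm htu.symm hst (weak u (Or.inl ⟨hu', hu''⟩)) ?_ ft'
      exact fs.resolve_left fun h => hsu (h.1.symm.trans hu')
    · exact core s t u hst hsu htu (weak s fs) ft' fu'

lemma proj_eq_none_iff {K : Type*} [Field K] (a b : K) : proj a b = none ↔ b = 0 := by
  simp [proj]

lemma proj_eq_some_iff {K : Type*} [Field K] (a b v : K) :
    proj a b = some v ↔ b ≠ 0 ∧ a = v * b := by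
  by_cases hb : b = 0
  · simp [proj, hb]
  · simp [proj, hb, div_eq_iff hb]

lemma P1map_eq_pairMap {K : Type*} [Field K] (f : RatFunc K) :
    P1map f = pairMap f.num f.denom := by
  funext x
  rcases x with _ | x <;> rfl

lemma rfIter_eq_div {K : Type*} [Field K] (f : RatFunc K) (d : ℕ)
    (hd : d = max f.num.natDegree f.denom.natDegree) (hd0 : 0 < d) (k : ℕ) :
    rfIter f k = algebraMap K[X] (RatFunc K) (iterPair d f.num f.denom k).1 /
      algebraMap K[X] (RatFunc K) (iterPair d f.num f.denom k).2 := by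
  induction k with
  | zero => simp [rfIter, iterPair, RatFunc.algebraMap_X]
  | succ k ih =>
    have h0 : algebraMap K[X] (RatFunc K) (iterPair d f.num f.denom k).2 ≠ 0 :=
      RatFunc.algebraMap_ne_zero
        (iterPair_snd_ne_zero _ _ d f.isCoprime_num_denom hd hd0 k)
    have h1 := map_homogEval (IsScalarTower.toAlgHom K K[X] (RatFunc K)) d f.num
      (iterPair d f.num f.denom k).1 (iterPair d f.num f.denom k).2
    have h2 := map_homogEval (IsScalarTower.toAlgHom K K[X] (RatFunc K)) d f.denom
      (iterPair d f.num f.denom k).1 (iterPair d f.num f.denom k).2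
    simp only [IsScalarTower.coe_toAlgHom'] at h1 h2
    simp only [rfIter, iterPair]
    rw [h1, h2, homogEval_of_ne_zero d _ (hd ▸ le_max_left _ _) _ _ h0,
      homogEval_of_ne_zero d _ (hd ▸ le_max_right _ _) _ _ h0,
      mul_div_mul_left _ _ (pow_ne_zero _ h0), ← ih, rfComp]

/-- If an iterate has no finite pole then it is a polynomial. -/
lemma isPoly_rfIter (f : RatFunc ℚ) (d : ℕ)
    (hd : d = max f.num.natDegree f.denom.natDegree) (hd0 : 0 < d) (k : ℕ)
    (h : ∀ z : ℂ, aeval z (iterPair d f.num f.denom k).2 ≠ 0) : (rfIter f k).IsPoly := by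
  have hG0 := iterPair_snd_ne_zero _ _ d f.isCoprime_num_denom hd hd0 k
  set G := (iterPair d f.num f.denom k).2 with hG
  have hdeg : G.degree = 0 := by
    by_contra hdeg
    obtain ⟨z, hz⟩ := IsAlgClosed.exists_aeval_eq_zero ℂ G hdeg
    exact h z hz
  obtain ⟨c, hc⟩ : ∃ c, G = C c := ⟨_, eq_C_of_degree_eq_zero hdeg⟩
  have hc0 : c ≠ 0 := by
    rintro rfl
    exact hG0 (by rw [hc, C_0])
  refine ⟨C c⁻¹ * (iterPair d f.num f.denom k).1, ?_⟩
  rw [rfIter_eq_div f d hd hd0 k, ← hG, div_eq_iff (RatFunc.algebraMap_ne_zero hG0), ← map_mul, hc]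
  congr 1
  rw [mul_right_comm, ← C_mul, inv_mul_cancel₀ hc0, C_1, one_mul]

/-- The fourth iterate has three poles on the complex projective line. -/
lemma exists_three_poles (f : RatFunc ℚ) (d : ℕ)
    (hd : d = max f.num.natDegree f.denom.natDegree) (hd2 : 2 ≤ d)
    (hpoly : ¬ (rfIter f 2).IsPoly) :
    (iterPair d f.num f.denom 4).2.coeff (d ^ 4) = 0 ∧ 0 < (iterPair d f.num f.denom 4).2.natDegree ∨
      ∃ S : Finset ℂ, 3 ≤ S.card ∧ ∀ β ∈ S, aeval β (iterPair d f.num f.denom 4).2 = 0 := by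
  have hd0 : 0 < d := by omega
  set p := f.num.map (algebraMap ℚ ℂ) with hp
  set q := f.denom.map (algebraMap ℚ ℂ) with hq
  have hpq : IsCoprime p q := (isCoprime_map _).mpr f.isCoprime_num_denom
  have hdC : d = max p.natDegree q.natDegree := by simpa [hp, hq] using hd
  have hsome : ∀ (k : ℕ) (z : ℂ), (pairMap p q)^[k] (some z) = none ↔
      aeval z (iterPair d f.num f.denom k).2 = 0 := by
    intro k z
    rw [(iterate_pairMap_some p q d hpq hdC hd0 k z).2, proj_eq_none_iff, hp, hq, map_iterPair,
      eval_map_algebraMap]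
  have hnone : ∀ k : ℕ, (pairMap p q)^[k] none = none ↔
      (iterPair d f.num f.denom k).2.coeff (d ^ k) = 0 := by
    intro k
    rw [(iterate_pairMap_none p q d hpq hdC hd0 k).2, proj_eq_none_iff, hp, hq, map_iterPair,
      coeff_map, map_eq_zero]
  obtain ⟨x, y, z, hxy, hxz, hyz, hx, hy, hz⟩ := exists_three_preimages (pairMap p q)
    (surjective_pairMap p q d hpq hdC hd0) none
    (fun a b c => no_three_totally_ramified p q d hpq hdC hd2 a b c)
    (fun h => hpoly (isPoly_rfIter f d hd hd0 2 fun w hw => by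
      have := (h (some w)).mp ((hsome 2 w).mpr hw)
      simp at this))
  have hinf : (pairMap p q)^[4] none = none → ∀ w : ℂ, (pairMap p q)^[4] (some w) = none →
      (iterPair d f.num f.denom 4).2.coeff (d ^ 4) = 0 ∧
        0 < (iterPair d f.num f.denom 4).2.natDegree := by
    intro h w hw
    refine ⟨(hnone 4).mp h, ?_⟩
    rw [hsome] at hw
    have h0 := iterPair_snd_ne_zero _ _ d f.isCoprime_num_denom hd hd0 4
    exact natDegree_pos_of_aeval_root h0 hw fun x hx => by simpa using hx
  rcases x with _ | x <;> rcases y with _ | y <;> rcases z with _ | z <;>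
    first
    | exact absurd rfl hxy
    | exact absurd rfl hxz
    | exact absurd rfl hyz
    | exact Or.inl (hinf hx y hy)
    | exact Or.inl (hinf hy x hx)
    | exact Or.inl (hinf hz x hx)
    | skip
  right
  rw [hsome] at hx hy hz
  refine ⟨{x, y, z}, ?_, ?_⟩
  · rw [Finset.card_eq_three.mpr ⟨x, y, z, ?_, ?_, ?_, rfl⟩]
    · exact fun h => hxy (by rw [h])
    · exact fun h => hxz (by rw [h])
    · exact fun h => hyz (by rw [h])
  · intro β hβ
    simp only [Finset.mem_insert, Finset.mem_singleton] at hβ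
    rcases hβ with rfl | rfl | rfl <;> assumption

end Silverman

open Silverman in
/-- Silverman: let f ∈ ℚ(X) have degree ≥ 2 with f² not a polynomial. Then
for every α ∈ ℚ, the forward orbit of α under f (as a self-map of P¹(ℚ)) contains only
finitely many integers. -/
theorem silverman_integer_points_in_orbit_finite
    (f : RatFunc ℚ) (hdeg : 2 ≤ max f.num.natDegree f.denom.natDegree)
    (hpoly : ¬ (rfIter f 2).IsPoly) (α : ℚ) :
    {k : ℤ | ∃ n : ℕ, (P1map f)^[n] (some α) = some (k : ℚ)}.Finite := by
  set d := max f.num.natDegree f.denom.natDegree with hd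
  have hd0 : 0 < d := by omega
  have hcop := f.isCoprime_num_denom
  set F := (iterPair d f.num f.denom 4).1 with hF
  set G := (iterPair d f.num f.denom 4).2 with hG
  have hdeg4 := natDegree_iterPair_le f.num f.denom d 4
  have hfin := finite_integral_values F G (isCoprime_iterPair _ _ d hcop hd hd0 4) (d ^ 4)
    hdeg4.1 hdeg4.2 (iterate_pairMap_none _ _ d hcop hd hd0 4).1
    (exists_three_poles f d hd hdeg hpoly)
  have hsub : ∀ T : Set (Option ℚ), T.Finite → {k : ℤ | some (k : ℚ) ∈ T}.Finite := by
    intro T hT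
    refine hT.preimage (Set.injOn_of_injective ?_)
    exact (Option.some_injective ℚ).comp Int.cast_injective
  refine (hsub _ (((Set.finite_Iio 4).image fun m => (P1map f)^[m] (some α)).union
    ((hfin.image fun r => (P1map f)^[4] (some r)).union
      (Set.finite_singleton ((P1map f)^[4] none))))).subset ?_
  rintro k ⟨m, hm⟩
  rw [Set.mem_ofPred_eq, ← hm]
  rcases lt_or_ge m 4 with h4 | h4
  · exact Or.inl ⟨m, h4, rfl⟩
  · right
    obtain ⟨l, rfl⟩ := Nat.exists_eq_add_of_le h4
    rw [Function.iterate_add_apply] at hm ⊢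
    generalize (P1map f)^[l] (some α) = x at hm ⊢
    rcases x with _ | r
    · exact Or.inr rfl
    · refine Or.inl ⟨r, ?_, rfl⟩
      rw [P1map_eq_pairMap, (iterate_pairMap_some _ _ d hcop hd hd0 4 r).2, proj_eq_some_iff] at hm
      exact ⟨hm.1, k, hm.2⟩
end
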